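/- arXiv:2403.04129 — 11 statements merged into one kernel-verified Lean document; each statement's English description precedes it below -/
import Mathlib

section
/- For every integer n ≥ 2, the function M_{G_n} : ℕ → ℕ, where M_{G_n}(k) is the number of magic k-labelings of the graph G_n, is a quasipolynomial whose minimum quasiperiod is exactly n − 1. -/
open Finset

/-- Vertices of the graph `G n`: `Sum.inl i` is `aᵢ`, `Sum.inr (Sum.inl i)` is `bᵢ`,
`Sum.inr (Sum.inr false)` is `x`, and `Sum.inr (Sum.inr true)` is `y`. -/
abbrev Vn (n : ℕ) := Fin n ⊕ Fin n ⊕ Bool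

def va {n : ℕ} (i : Fin n) : Vn n := Sum.inl i
def vb {n : ℕ} (i : Fin n) : Vn n := Sum.inr (Sum.inl i)
def vx {n : ℕ} : Vn n := Sum.inr (Sum.inr false)
def vy {n : ℕ} : Vn n := Sum.inr (Sum.inr true)

/-- The edge set of the graph `Gₙ`: edges `aᵢbᵢ`, `x aᵢ` and `y bᵢ` for `1 ≤ i ≤ n`. -/
def Gedges (n : ℕ) : Finset (Sym2 (Vn n)) :=
  (Finset.univ.image fun i : Fin n => s(va i, vb i)) ∪
  (Finset.univ.image fun i : Fin n => s(vx, va i)) ∪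
  (Finset.univ.image fun i : Fin n => s(vy, vb i))

/-- Sum of the labels of the edges incident to `v`. -/
def vsum {V : Type} [DecidableEq V] (E : Finset (Sym2 V)) (L : E → ℕ) (v : V) : ℕ :=
  ∑ e ∈ E.attach, if v ∈ e.1 then L e else 0

/-- A labeling is magic if the label sum is the same at every vertex. -/
def IsMagic {V : Type} [DecidableEq V] (E : Finset (Sym2 V)) (L : E → ℕ) : Prop :=
  ∀ v w : V, vsum E L v = vsum E L w

/-- `magicCount E k` is the number of magic `k`-labelings, i.e. magic labelings
with all labels at most `k`. -/
noncomputable def magicCount {V : Type} [DecidableEq V] (E : Finset (Sym2 V)) (k : ℕ) : ℕ :=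
  Set.ncard {L : E → ℕ | IsMagic E L ∧ ∀ e, L e ≤ k}

/-- `F` is a quasipolynomial with quasiperiod `s`. -/
def IsQuasiPoly (F : ℕ → ℚ) (s : ℕ) : Prop :=
  0 < s ∧ ∃ φ : ℕ → Polynomial ℚ, ∀ t : ℕ, F t = (φ (t % s)).eval (t : ℚ)

/-- A function which agrees for large arguments with a polynomial on each residue class mod `s`. -/
def EventuallyQuasiPoly (s : ℕ) (f : ℕ → ℚ) : Prop :=
  ∃ (N : ℕ) (φ : ℕ → Polynomial ℚ), (∀ t, φ (t + s) = φ t) ∧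
    ∀ t, N ≤ t → f t = (φ t).eval (t : ℚ)

lemma IsQuasiPoly.eventuallyQuasiPoly {F : ℕ → ℚ} {s : ℕ} (h : IsQuasiPoly F s) :
    EventuallyQuasiPoly s F := by
  obtain ⟨-, φ, hφ⟩ := h
  exact ⟨0, fun t => φ (t % s), fun t => by simp, fun t _ => hφ t⟩

lemma EventuallyQuasiPoly.coeff_one_sub_X_mul {s : ℕ} (hs : 0 < s) {f : PowerSeries ℚ}
    (hf : EventuallyQuasiPoly s fun k => f.coeff k) :
    EventuallyQuasiPoly s fun k => ((1 - PowerSeries.X) * f).coeff k := by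
  obtain ⟨N, φ, hφ, h⟩ := hf
  dsimp only at h
  refine ⟨N + 1, fun t => φ t - (φ (t + (s - 1))).comp (Polynomial.X - 1), fun t => ?_, ?_⟩
  · dsimp only
    rw [show t + s + (s - 1) = t + (s - 1) + s by ring, hφ, hφ]
  · intro t ht
    obtain ⟨u, rfl⟩ : ∃ u, t = u + 1 := ⟨t - 1, by omega⟩
    have e : φ (u + 1 + (s - 1)) = φ u := by
      rw [← hφ u]; congr 1; omega
    simp only [e, sub_mul, one_mul, map_sub, PowerSeries.coeff_succ_X_mul, Polynomial.eval_sub,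
      Polynomial.eval_comp, Polynomial.eval_X, Polynomial.eval_one]
    rw [h u (by omega), h (u + 1) (by omega)]
    simp

lemma EventuallyQuasiPoly.coeff_one_sub_X_pow_mul {s : ℕ} (hs : 0 < s) {f : PowerSeries ℚ}
    (hf : EventuallyQuasiPoly s fun k => f.coeff k) (n : ℕ) :
    EventuallyQuasiPoly s fun k => ((1 - PowerSeries.X) ^ n * f).coeff k := by
  induction n with
  | zero => simpa using hf
  | succ n ih =>
    rw [pow_succ', mul_assoc]
    exact ih.coeff_one_sub_X_mul hs

/-- An eventually quasipolynomial function with values in `{1, 2}` is eventually periodic. -/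
lemma EventuallyQuasiPoly.eventually_periodic {s : ℕ} (hs : 0 < s) {f : ℕ → ℚ}
    (hf : EventuallyQuasiPoly s f) (hv : ∀ t, f t = 1 ∨ f t = 2) :
    ∃ N, ∀ t, N ≤ t → f (t + s) = f t := by
  obtain ⟨N, φ, hφ, h⟩ := hf
  refine ⟨N, fun t ht => ?_⟩
  have hper : ∀ m, φ (t + s * m) = φ t := by
    intro m
    induction m with
    | zero => simp
    | succ m ih => rw [mul_add, mul_one, ← add_assoc, hφ, ih]
  have hz : (φ t - 1) * (φ t - 2) = 0 := by
    apply Polynomial.eq_zero_of_infinite_isRoot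
    apply Set.infinite_of_injective_forall_mem (f := fun m : ℕ => ((t + s * m : ℕ) : ℚ))
    · intro a b hab
      have := Nat.cast_injective hab
      exact Nat.eq_of_mul_eq_mul_left hs (by omega)
    · intro m
      have e := h (t + s * m) (by omega)
      rw [hper] at e
      have e2 : Polynomial.eval ((t + s * m : ℕ) : ℚ) (2 : Polynomial ℚ) = 2 :=
        Polynomial.eval_ofNat 2 _
      simp only [Set.mem_ofPred_eq, Polynomial.IsRoot, Polynomial.eval_mul, Polynomial.eval_sub,
        Polynomial.eval_one, e2, ← e]
      rcases hv (t + s * m) with h | h <;> rw [h] <;> norm_num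
  have hc : ∃ c, φ t = Polynomial.C c := by
    rcases mul_eq_zero.mp hz with h | h
    · exact ⟨1, by simpa using sub_eq_zero.mp h⟩
    · exact ⟨2, by rw [sub_eq_zero.mp h]; rfl⟩
  obtain ⟨c, hc⟩ := hc
  rw [h _ ht, h _ (by omega), hφ, hc]
  simp

open PowerSeries in
/-- The coefficients of `(1 + X + ⋯ + X ^ d) / (1 - X ^ d)`. -/
lemma coeff_eq_of_mul_one_sub_X_pow {d : ℕ} (hd : 0 < d) {D : ℚ⟦X⟧}
    (hD : D * (1 - X ^ d) = ∑ i ∈ range (d + 1), X ^ i) (k : ℕ) :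
    D.coeff k = if 0 < k ∧ d ∣ k then 2 else 1 := by
  have hc : ∀ k, D.coeff k - (if d ≤ k then D.coeff (k - d) else 0) = if k ≤ d then 1 else 0 := by
    intro k
    have := congrArg (coeff k) hD
    rw [mul_sub, mul_one, map_sub, coeff_mul_X_pow', map_sum] at this
    simpa [coeff_X_pow, Nat.lt_succ_iff] using this
  induction k using Nat.strong_induction_on with
  | _ k ih =>
    have := hc k
    by_cases hk : d ≤ k
    · obtain ⟨j, rfl⟩ := Nat.exists_eq_add_of_le' hk
      have hj := ih j (by omega)
      simp only [hk, if_true, Nat.add_sub_cancel, hj] at this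
      have hdj : d ∣ j + d ↔ d ∣ j := by simp
      simp only [hdj]
      rcases Nat.eq_zero_or_pos j with rfl | hj0
      · simp_all
        linarith
      · have : ¬ (j + d ≤ d) := by omega
        simp_all
        linarith
    · have h2 : ¬ (0 < k ∧ d ∣ k) := fun h => hk (Nat.le_of_dvd h.1 h.2)
      rw [if_neg h2]
      simpa [hk, (not_le.mp hk).le] using this

open PowerSeries in
/-- Every quasiperiod of the coefficients of `(1 - X ^ (d + 1)) / ((1 - X) ^ (d + 2) * (1 - X ^ d))`
is at least `d`. -/
lemma le_of_isQuasiPoly {d : ℕ} (hd : 0 < d) {M : ℚ⟦X⟧}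
    (hM : M * (1 - X ^ d) * (1 - X) ^ (d + 2) = 1 - X ^ (d + 1)) {s : ℕ}
    (h : IsQuasiPoly (fun k => M.coeff k) s) : d ≤ s := by
  have hs := h.1
  have hD : ((1 - X) ^ (d + 1) * M) * (1 - X ^ d) = ∑ i ∈ range (d + 1), X ^ i := by
    have h1 : (1 - X : ℚ⟦X⟧) ≠ 0 := by
      intro h0
      simpa using congrArg (coeff 0) h0
    apply mul_left_cancel₀ h1
    rw [mul_neg_geom_sum, ← hM]
    ring
  have hco := coeff_eq_of_mul_one_sub_X_pow hd hD
  obtain ⟨N, hN⟩ := (h.eventuallyQuasiPoly.coeff_one_sub_X_pow_mul hs (d + 1)).eventually_periodic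
    hs (fun t => by rw [hco]; split_ifs <;> simp)
  have := hN (d * (N + 1)) (by nlinarith)
  have hpos : 0 < d * (N + 1) := by positivity
  rw [hco, hco (d * (N + 1)), if_pos (c := 0 < d * (N + 1) ∧ _) ⟨hpos, dvd_mul_right _ _⟩] at this
  have hdvd : d ∣ d * (N + 1) + s := by
    by_contra hcon
    rw [if_neg (fun h => hcon h.2)] at this
    norm_num at this
  exact Nat.le_of_dvd hs ((Nat.dvd_add_right (dvd_mul_right _ _)).mp hdvd)

lemma exists_polynomial_sum_range (P : Polynomial ℚ) :
    ∃ Q : Polynomial ℚ, ∀ q : ℕ, ∑ i ∈ range q, P.eval (i : ℚ) = Q.eval (q : ℚ) := by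
  induction P using Polynomial.induction_on' with
  | add p q hp hq =>
    obtain ⟨P, hP⟩ := hp
    obtain ⟨Q, hQ⟩ := hq
    exact ⟨P + Q, fun m => by simp [Finset.sum_add_distrib, hP, hQ]⟩
  | monomial p a =>
    refine ⟨Polynomial.C a * ∑ i ∈ range (p + 1), Polynomial.C (bernoulli i * ((p + 1).choose i) /
      (p + 1)) * Polynomial.X ^ (p + 1 - i), fun m => ?_⟩
    simp only [Polynomial.eval_monomial, ← Finset.mul_sum, sum_range_pow, Polynomial.eval_mul,
      Polynomial.eval_C, Polynomial.eval_finsetSum, Polynomial.eval_pow, Polynomial.eval_X]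
    congr 1
    refine Finset.sum_congr rfl fun i _ => ?_
    ring

lemma isQuasiPoly_of_recurrence {d : ℕ} (hd : 0 < d) {F : ℕ → ℚ} (P : Polynomial ℚ)
    (h : ∀ k, F k = P.eval (k : ℚ) + if d ≤ k then F (k - d) else 0) : IsQuasiPoly F d := by
  have hex : ∀ r : ℕ, ∃ Q : Polynomial ℚ, ∀ q : ℕ,
      ∑ i ∈ range q, P.eval ((r + d * i : ℕ) : ℚ) = Q.eval (q : ℚ) := by
    intro r
    obtain ⟨Q, hQ⟩ := exists_polynomial_sum_range
      (P.comp (Polynomial.C (r : ℚ) + Polynomial.C (d : ℚ) * Polynomial.X))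
    exact ⟨Q, fun q => by rw [← hQ]; simp⟩
  choose Q hQ using hex
  have hF : ∀ r < d, ∀ q : ℕ, F (r + d * q) = (Q r).eval ((q + 1 : ℕ) : ℚ) := by
    intro r hr q
    rw [← hQ]
    induction q with
    | zero => rw [h]; simp [hr]
    | succ q ih =>
      rw [Finset.sum_range_succ, ← ih, h, if_pos (by nlinarith), add_comm]
      congr 2
      rw [mul_add, mul_one, ← add_assoc, Nat.add_sub_cancel]
  refine ⟨hd, fun r => (Q r).comp
    ((Polynomial.X - Polynomial.C (r : ℚ)) * Polynomial.C ((d : ℚ)⁻¹) + 1), fun t => ?_⟩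
  have hd' : (d : ℚ) ≠ 0 := by positivity
  conv_lhs => rw [← Nat.mod_add_div t d]
  rw [hF _ (Nat.mod_lt _ hd), Polynomial.eval_comp]
  congr 1
  simp only [Polynomial.eval_add, Polynomial.eval_mul, Polynomial.eval_sub, Polynomial.eval_X,
    Polynomial.eval_C, Polynomial.eval_one]
  have e : (t : ℚ) = (t % d : ℕ) + d * (t / d : ℕ) := by
    exact_mod_cast (Nat.mod_add_div t d).symm
  push_cast
  rw [eq_comm, add_left_inj, ← div_eq_mul_inv, div_eq_iff hd', sub_eq_iff_eq_add]
  linarith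

lemma exists_polynomial_choose_sub (n : ℕ) :
    ∃ P : Polynomial ℚ, ∀ k : ℕ, ((k + n).choose n : ℚ) - k.choose n = P.eval (k : ℚ) := by
  refine ⟨Polynomial.C ((n.factorial : ℚ)⁻¹) * ((descPochhammer ℚ n).comp
    (Polynomial.X + Polynomial.C (n : ℚ)) - descPochhammer ℚ n), fun k => ?_⟩
  rw [Nat.cast_choose_eq_descPochhammer_div, Nat.cast_choose_eq_descPochhammer_div]
  simp only [Polynomial.eval_mul, Polynomial.eval_sub, Polynomial.eval_comp, Polynomial.eval_add,
    Polynomial.eval_X, Polynomial.eval_C]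
  push_cast
  ring

lemma ncard_sum_le (n k : ℕ) :
    {p : Fin n → ℕ | ∑ i, p i ≤ k}.ncard = (k + n).choose n := by
  have h : {p : Fin n → ℕ | ∑ i, p i ≤ k}.ncard =
      {p : Fin (n + 1) → ℕ | ∑ i, p i = k}.ncard := by
    symm
    refine Set.ncard_congr (fun p _ => Fin.tail p) ?_ ?_ ?_
    · intro p hp
      simp only [Set.mem_ofPred_eq, Fin.sum_univ_succ, Fin.tail] at hp ⊢
      omega
    · intro p q hp hq hpq
      have ht : ∑ i, Fin.tail p i = ∑ i, Fin.tail q i := by rw [hpq]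
      simp only [Set.mem_ofPred_eq, Fin.sum_univ_succ, Fin.tail] at hp hq ht
      rw [← Fin.cons_self_tail p, ← Fin.cons_self_tail q, hpq]
      congr 1
      omega
    · intro q hq
      simp only [Set.mem_ofPred_eq] at hq
      exact ⟨Fin.cons (k - ∑ i, q i) q, by simp [Fin.sum_univ_succ]; omega, by simp⟩
  rw [h, ← Nat.card_coe_set_eq]
  have e : Nat.card {p : Fin (n + 1) → ℕ | ∑ i, p i = k} = Nat.card (Sym (Fin (n + 1)) k) :=
    (Nat.card_congr (Sym.equivNatSumOfFintype (Fin (n + 1)) k)).symm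
  rw [e, Nat.card_eq_fintype_card, Sym.card_sym_eq_choose, Fintype.card_fin,
    show n + 1 + k - 1 = k + n by omega, Nat.choose_symm_add]

lemma finite_sum_le (n k : ℕ) : {p : Fin n → ℕ | ∑ i, p i ≤ k}.Finite := by
  apply Set.finite_of_ncard_ne_zero
  rw [ncard_sum_le]
  exact (Nat.choose_pos (by omega)).ne'

lemma finite_sum_le_add {n : ℕ} (hn : 2 ≤ n) (k : ℕ) :
    {p : Fin n → ℕ | ∀ i, ∑ j, p j ≤ k + p i}.Finite := by
  refine (finite_sum_le n (2 * k)).subset fun p hp => ?_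
  simp only [Set.mem_ofPred_eq] at hp ⊢
  have h0 := hp ⟨0, by omega⟩
  have h1 := hp ⟨1, by omega⟩
  have h2 : p ⟨0, by omega⟩ + p ⟨1, by omega⟩ ≤ ∑ j, p j :=
    Finset.add_le_sum (f := p) (fun _ _ => Nat.zero_le _) (Finset.mem_univ _) (Finset.mem_univ _)
      (by simp)
  omega

lemma sum_add_one (n : ℕ) (p : Fin n → ℕ) : ∑ i, (p i + 1) = ∑ i, p i + n := by
  simp [Finset.sum_add_distrib]

/-- Translation by the all-ones vector identifies a set with the positive vectors of another. -/
lemma ncard_inter_pos {n : ℕ} {S T : Set (Fin n → ℕ)} (h : ∀ p, p + 1 ∈ S ↔ p ∈ T) :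
    (S ∩ {p | ∀ i, 0 < p i}).ncard = T.ncard := by
  symm
  refine Set.ncard_congr (fun p _ => p + 1) ?_ ?_ ?_
  · exact fun p hp => ⟨(h p).mpr hp, fun i => by simp⟩
  · exact fun p q _ _ hpq => add_right_cancel hpq
  · intro p ⟨hp, hpos⟩
    have e : (fun i => p i - 1) + 1 = p := by
      ext i
      have := hpos i
      simp only [Pi.add_apply, Pi.one_apply]
      omega
    exact ⟨_, (h _).mp (e ▸ hp), e⟩

lemma ncard_sum_le_inter_pos {n : ℕ} (k : ℕ) :
    ({p : Fin n → ℕ | ∑ i, p i ≤ k} ∩ {p | ∀ i, 0 < p i}).ncard = k.choose n := by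
  by_cases hk : n ≤ k
  · rw [ncard_inter_pos (T := {p : Fin n → ℕ | ∑ i, p i ≤ k - n}), ncard_sum_le,
      Nat.sub_add_cancel hk]
    intro p
    simp only [Set.mem_ofPred_eq, Pi.add_apply, Pi.one_apply, sum_add_one]
    omega
  · rw [ncard_inter_pos (T := ∅), Set.ncard_empty, Nat.choose_eq_zero_of_lt (by omega)]
    intro p
    simp only [Set.mem_ofPred_eq, Pi.add_apply, Pi.one_apply, sum_add_one,
      Set.mem_empty_iff_false, iff_false]
    omega

lemma ncard_sum_le_add_inter_pos {n : ℕ} (hn : 2 ≤ n) (k : ℕ) :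
    ({p : Fin n → ℕ | ∀ i, ∑ j, p j ≤ k + p i} ∩ {p | ∀ i, 0 < p i}).ncard =
      if n - 1 ≤ k then {p : Fin n → ℕ | ∀ i, ∑ j, p j ≤ (k - (n - 1)) + p i}.ncard else 0 := by
  split_ifs with hk
  · apply ncard_inter_pos
    intro p
    simp only [Set.mem_ofPred_eq, sum_add_one, Pi.add_apply, Pi.one_apply]
    exact forall_congr' fun i => by omega
  · rw [ncard_inter_pos (T := ∅), Set.ncard_empty]
    intro p
    simp only [Set.mem_ofPred_eq, sum_add_one, Set.mem_empty_iff_false, iff_false, not_forall,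
      Pi.add_apply, Pi.one_apply]
    refine ⟨⟨0, by omega⟩, ?_⟩
    have := Finset.single_le_sum (f := p) (fun _ _ => Nat.zero_le _)
      (Finset.mem_univ (⟨0, by omega⟩ : Fin n))
    omega

lemma ncard_sum_le_add_recurrence {n : ℕ} (hn : 2 ≤ n) (k : ℕ) :
    {p : Fin n → ℕ | ∀ i, ∑ j, p j ≤ k + p i}.ncard + k.choose n = (k + n).choose n +
      if n - 1 ≤ k then {p : Fin n → ℕ | ∀ i, ∑ j, p j ≤ (k - (n - 1)) + p i}.ncard else 0 := by
  have hdiff : {p : Fin n → ℕ | ∀ i, ∑ j, p j ≤ k + p i} \ {p | ∀ i, 0 < p i} =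
      {p : Fin n → ℕ | ∑ j, p j ≤ k} \ {p | ∀ i, 0 < p i} := by
    ext p
    simp only [Set.mem_sdiff, Set.mem_ofPred_eq, and_congr_left_iff, not_forall, not_lt,
      Nat.le_zero]
    rintro ⟨i, hi⟩
    exact ⟨fun h => by simpa [hi] using h i, fun h j => h.trans (Nat.le_add_right _ _)⟩
  have h1 := Set.ncard_inter_add_ncard_sdiff_eq_ncard {p : Fin n → ℕ | ∀ i, ∑ j, p j ≤ k + p i}
    {p | ∀ i, 0 < p i} (finite_sum_le_add hn k)
  have h2 := Set.ncard_inter_add_ncard_sdiff_eq_ncard {p : Fin n → ℕ | ∑ j, p j ≤ k}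
    {p | ∀ i, 0 < p i} (finite_sum_le n k)
  rw [hdiff, ncard_sum_le_add_inter_pos hn] at h1
  rw [ncard_sum_le_inter_pos, ncard_sum_le] at h2
  omega

lemma sum_Gedges {n : ℕ} (f : Sym2 (Vn n) → ℕ) :
    ∑ e ∈ Gedges n, f e = ∑ i, f s(va i, vb i) + ∑ i, f s(vx, va i) + ∑ i, f s(vy, vb i) := by
  rw [Gedges, Finset.sum_union, Finset.sum_union, Finset.sum_image, Finset.sum_image,
    Finset.sum_image]
  · intro i _ j _ h
    simpa [va, vb, vx, vy] using h
  · intro i _ j _ h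
    simpa [va, vb, vx, vy] using h
  · intro i _ j _ h
    simpa [va, vb, vx, vy] using h
  · simp [Finset.disjoint_left, va, vb, vx]
  · rw [Finset.disjoint_left]
    rintro e he
    simp only [Finset.mem_union, Finset.mem_image, Finset.mem_univ, true_and] at he
    rcases he with ⟨i, rfl⟩ | ⟨i, rfl⟩ <;> simp [va, vb, vx, vy]

/-- Extension by zero of a labeling to all unordered pairs. -/
def extendLabel {V : Type} [DecidableEq V] {E : Finset (Sym2 V)} (L : E → ℕ) (e : Sym2 V) : ℕ :=
  if h : e ∈ E then L ⟨e, h⟩ else 0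

lemma extendLabel_coe {V : Type} [DecidableEq V] {E : Finset (Sym2 V)} (L : E → ℕ) (e : E) :
    extendLabel L e = L e := by
  simp [extendLabel]

lemma vsum_eq_sum_extendLabel {V : Type} [DecidableEq V] {E : Finset (Sym2 V)} (L : E → ℕ)
    (v : V) : vsum E L v = ∑ e ∈ E, if v ∈ e then extendLabel L e else 0 := by
  rw [vsum, ← Finset.sum_attach E]
  simp only [extendLabel_coe]

lemma vsum_Gedges {n : ℕ} (L : Gedges n → ℕ) :
    (∀ i, vsum (Gedges n) L (va i) =
      extendLabel L s(va i, vb i) + extendLabel L s(vx, va i)) ∧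
    (∀ i, vsum (Gedges n) L (vb i) =
      extendLabel L s(va i, vb i) + extendLabel L s(vy, vb i)) ∧
    vsum (Gedges n) L vx = ∑ i, extendLabel L s(vx, va i) ∧
    vsum (Gedges n) L vy = ∑ i, extendLabel L s(vy, vb i) := by
  simp only [vsum_eq_sum_extendLabel, sum_Gedges]
  refine ⟨fun i => ?_, fun i => ?_, ?_, ?_⟩ <;> simp [va, vb, vx, vy]

lemma isMagic_Gedges_iff {n : ℕ} (L : Gedges n → ℕ) :
    IsMagic (Gedges n) L ↔ ∀ i, extendLabel L s(vy, vb i) = extendLabel L s(vx, va i) ∧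
      extendLabel L s(va i, vb i) + extendLabel L s(vx, va i) =
        ∑ j, extendLabel L s(vx, va j) := by
  obtain ⟨ha, hb, hx, hy⟩ := vsum_Gedges L
  constructor
  · intro h i
    have h1 := h (va i) vx
    have h2 := h (vb i) vx
    rw [ha, hx] at h1
    rw [hb, hx] at h2
    omega
  · intro h
    have hall : ∀ v, vsum (Gedges n) L v = ∑ j, extendLabel L s(vx, va j) := by
      rintro (i | i | _ | _)
      · exact (ha i).trans (h i).2
      · refine (hb i).trans ?_
        rw [(h i).1, (h i).2]
      · exact hx
      · refine hy.trans (Finset.sum_congr rfl fun i _ => (h i).1)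
    intro v w
    rw [hall, hall]

lemma mem_Gedges {n : ℕ} {e : Sym2 (Vn n)} : e ∈ Gedges n ↔
    (∃ i, s(va i, vb i) = e) ∨ (∃ i, s(vx, va i) = e) ∨ ∃ i, s(vy, vb i) = e := by
  simp only [Gedges, Finset.mem_union, Finset.mem_image, Finset.mem_univ, true_and, or_assoc]

/-- The magic labeling of `G n` with label `p i` on the edge `x aᵢ`. -/
def magicLabel {n : ℕ} (p : Fin n → ℕ) (e : Gedges n) : ℕ :=
  ∑ i, ((if e.1 = s(vx, va i) then p i else 0) + (if e.1 = s(vy, vb i) then p i else 0) +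
    if e.1 = s(va i, vb i) then ∑ j, p j - p i else 0)

lemma extendLabel_magicLabel {n : ℕ} (p : Fin n → ℕ) (i : Fin n) :
    extendLabel (magicLabel p) s(vx, va i) = p i ∧
    extendLabel (magicLabel p) s(vy, vb i) = p i ∧
    extendLabel (magicLabel p) s(va i, vb i) = ∑ j, p j - p i := by
  refine ⟨?_, ?_, ?_⟩ <;>
    rw [extendLabel, dif_pos (by simp [Gedges, va, vb, vx, vy])] <;> simp [magicLabel, va, vb, vx, vy]

lemma forall_label_le_iff {n : ℕ} {L : Gedges n → ℕ} {k : ℕ} : (∀ e, L e ≤ k) ↔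
    ∀ i, extendLabel L s(va i, vb i) ≤ k ∧ extendLabel L s(vx, va i) ≤ k ∧
      extendLabel L s(vy, vb i) ≤ k := by
  constructor
  · intro h i
    refine ⟨?_, ?_, ?_⟩ <;> rw [extendLabel, dif_pos (by simp [Gedges, va, vb, vx, vy])] <;> exact h _
  · rintro h e
    rw [← extendLabel_coe L e]
    rcases mem_Gedges.mp e.2 with ⟨i, hi⟩ | ⟨i, hi⟩ | ⟨i, hi⟩ <;> rw [← hi]
    · exact (h i).1
    · exact (h i).2.1
    · exact (h i).2.2

lemma eq_of_extendLabel_eq {n : ℕ} {L L' : Gedges n → ℕ}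
    (h : ∀ i, extendLabel L s(va i, vb i) = extendLabel L' s(va i, vb i) ∧
      extendLabel L s(vx, va i) = extendLabel L' s(vx, va i) ∧
      extendLabel L s(vy, vb i) = extendLabel L' s(vy, vb i)) : L = L' := by
  funext e
  rw [← extendLabel_coe L e, ← extendLabel_coe L' e]
  rcases mem_Gedges.mp e.2 with ⟨i, hi⟩ | ⟨i, hi⟩ | ⟨i, hi⟩ <;> rw [← hi]
  · exact (h i).1
  · exact (h i).2.1
  · exact (h i).2.2

lemma magicCount_Gedges {n : ℕ} (hn : 2 ≤ n) (k : ℕ) :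
    magicCount (Gedges n) k = {p : Fin n → ℕ | ∀ i, ∑ j, p j ≤ k + p i}.ncard := by
  refine Set.ncard_congr (fun L _ i => extendLabel L s(vx, va i)) ?_ ?_ ?_
  · rintro L ⟨hL, hk⟩ i
    have h1 := (isMagic_Gedges_iff L).mp hL i
    have h2 := forall_label_le_iff.mp hk i
    dsimp only
    omega
  · rintro L L' ⟨hL, -⟩ ⟨hL', -⟩ h
    apply eq_of_extendLabel_eq
    intro i
    have hi : ∀ j, extendLabel L s(vx, va j) = extendLabel L' s(vx, va j) := congrFun h
    have h1 := (isMagic_Gedges_iff L).mp hL i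
    have h2 := (isMagic_Gedges_iff L').mp hL' i
    have h3 := hi i
    simp only [hi] at h1
    omega
  · intro p hp
    have hle : ∀ i, p i ≤ ∑ j, p j := fun i =>
      Finset.single_le_sum (f := p) (fun _ _ => Nat.zero_le _) (Finset.mem_univ i)
    have hE := extendLabel_magicLabel p
    refine ⟨magicLabel p, ⟨(isMagic_Gedges_iff _).mpr fun i => ?_,
      forall_label_le_iff.mpr fun i => ?_⟩, ?_⟩
    · simp only [hE, true_and]
      exact Nat.sub_add_cancel (hle i)
    · have : Nontrivial (Fin n) := Fin.nontrivial_iff_two_le.mpr hn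
      obtain ⟨j, hj⟩ := exists_ne i
      have hadd : p i + p j ≤ ∑ j, p j :=
        Finset.add_le_sum (f := p) (fun _ _ => Nat.zero_le _) (Finset.mem_univ _)
          (Finset.mem_univ _) hj.symm
      have h1 := hp i
      have h2 := hp j
      simp only [hE]
      omega
    · funext i
      exact (hE i).1

lemma magicCount_Gedges_recurrence {n : ℕ} (hn : 2 ≤ n) (k : ℕ) :
    magicCount (Gedges n) k + k.choose n = (k + n).choose n +
      if n - 1 ≤ k then magicCount (Gedges n) (k - (n - 1)) else 0 := by
  simp only [magicCount_Gedges hn]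
  exact ncard_sum_le_add_recurrence hn k

open PowerSeries in
lemma mk_magicCount_Gedges {d : ℕ} (hd : 0 < d) :
    (PowerSeries.mk fun k => (magicCount (Gedges (d + 1)) k : ℚ)) * (1 - X ^ d) * (1 - X) ^ (d + 2) =
      1 - X ^ (d + 1) := by
  have h : (PowerSeries.mk fun k => (magicCount (Gedges (d + 1)) k : ℚ)) * (1 - X ^ d) =
      (PowerSeries.mk fun k => ((d + 1 + k).choose (d + 1) : ℚ)) * (1 - X ^ (d + 1)) := by
    ext k
    have hr := magicCount_Gedges_recurrence (n := d + 1) (by omega) k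
    have hr' := congrArg (Nat.cast : ℕ → ℚ) hr
    simp only [mul_sub, mul_one, map_sub, coeff_mul_X_pow', coeff_mk]
    have hc : (if d + 1 ≤ k then ((d + 1 + (k - (d + 1))).choose (d + 1) : ℚ) else 0) =
        k.choose (d + 1) := by
      split_ifs with hk
      · rw [Nat.add_sub_cancel' hk]
      · rw [Nat.choose_eq_zero_of_lt (by omega), Nat.cast_zero]
    rw [hc]
    push_cast [Nat.add_sub_cancel] at hr'
    rw [add_comm k (d + 1)] at hr'
    linarith
  rw [h, mul_right_comm, mk_add_choose_mul_one_sub_pow_eq_one ℚ (d + 1), one_mul]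

/-- For every `n ≥ 2`, the counting function `M_{Gₙ}` is a quasipolynomial with
minimum quasiperiod exactly `n - 1`. -/
theorem magicCount_Gn_minimum_quasiperiod (n : ℕ) (hn : 2 ≤ n) :
    IsLeast {s : ℕ | IsQuasiPoly (fun k => (magicCount (Gedges n) k : ℚ)) s} (n - 1) := by
  constructor
  · obtain ⟨P, hP⟩ := exists_polynomial_choose_sub n
    refine isQuasiPoly_of_recurrence (by omega) P fun k => ?_
    have h := congrArg (Nat.cast : ℕ → ℚ) (magicCount_Gedges_recurrence hn k)
    push_cast at h
    rw [← hP]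
    linarith
  · intro s hs
    obtain ⟨d, rfl⟩ : ∃ d, n = d + 1 := ⟨n - 1, by omega⟩
    exact le_of_isQuasiPoly (by omega) (mk_magicCount_Gedges (by omega)) (by simpa using hs)
end

section
/- For every integer n ≥ 2, the point of ℝ^E (E the edge set of G_n) assigning the value 1 to each edge a_i b_i and the value 1/(n−1) to each edge x a_i and y b_i is an extreme point of the convex set P_{G_n} = { L : E → ℝ : 0 ≤ L(e) ≤ 1 for all e ∈ E, and s_L(v) is the same for all vertices v }. -/
open Finset

/-- Sum of the (real) labels of the edges incident to `v`. -/
def vsumR {V : Type} [DecidableEq V] (E : Finset (Sym2 V)) (L : E → ℝ) (v : V) : ℝ :=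
  ∑ e ∈ E.attach, if v ∈ e.1 then L e else 0

/-- The polytope `P_G ⊆ ℝ^E` of fractional magic labelings with labels in `[0,1]`. -/
def magicPolytope {V : Type} [DecidableEq V] (E : Finset (Sym2 V)) : Set (E → ℝ) :=
  {L | (∀ e, 0 ≤ L e ∧ L e ≤ 1) ∧ ∀ v w : V, vsumR E L v = vsumR E L w}

/-- The labeling of `Gₙ` assigning `1` to each edge `aᵢbᵢ` and `1/(n-1)` to each edge
`x aᵢ` and `y bᵢ` (the latter being exactly the edges containing `x` or `y`). -/
noncomputable def Lstar (n : ℕ) : ↥(Gedges n) → ℝ :=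
  fun e => if (vx : Vn n) ∈ e.1 ∨ (vy : Vn n) ∈ e.1 then ((n : ℝ) - 1)⁻¹ else 1

def edgeAB {n : ℕ} (i : Fin n) : Gedges n := ⟨s(va i, vb i), by simp [Gedges, va, vb, vx, vy]⟩
def edgeXA {n : ℕ} (i : Fin n) : Gedges n := ⟨s(vx, va i), by simp [Gedges, va, vb, vx, vy]⟩
def edgeYB {n : ℕ} (i : Fin n) : Gedges n := ⟨s(vy, vb i), by simp [Gedges, va, vb, vx, vy]⟩

theorem Gedges_cases {n : ℕ} (e : Gedges n) :
    (∃ i, e = edgeAB i) ∨ (∃ i, e = edgeXA i) ∨ ∃ i, e = edgeYB i := by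
  obtain ⟨e, he⟩ := e
  simp only [Gedges, mem_union, mem_image, mem_univ, true_and] at he
  rcases he with (⟨i, rfl⟩ | ⟨i, rfl⟩) | ⟨i, rfl⟩
  · exact Or.inl ⟨i, rfl⟩
  · exact Or.inr (Or.inl ⟨i, rfl⟩)
  · exact Or.inr (Or.inr ⟨i, rfl⟩)

theorem edge_bijective (n : ℕ) :
    Function.Bijective (Sum.elim edgeAB (Sum.elim edgeXA edgeYB) :
      Fin n ⊕ Fin n ⊕ Fin n → Gedges n) := by
  constructor
  · rintro (i | i | i) (j | j | j) h <;>
      simp_all [edgeAB, edgeXA, edgeYB, va, vb, vx, vy]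
  · intro e
    rcases Gedges_cases e with ⟨i, rfl⟩ | ⟨i, rfl⟩ | ⟨i, rfl⟩
    · exact ⟨Sum.inl i, rfl⟩
    · exact ⟨Sum.inr (Sum.inl i), rfl⟩
    · exact ⟨Sum.inr (Sum.inr i), rfl⟩

theorem sum_Gedges_s1 {n : ℕ} (f : Gedges n → ℝ) :
    ∑ e ∈ (Gedges n).attach, f e =
      ∑ i, f (edgeAB i) + (∑ i, f (edgeXA i) + ∑ i, f (edgeYB i)) := by
  rw [← univ_eq_attach, ← (edge_bijective n).sum_comp]
  simp

theorem vsumR_va {n : ℕ} (L : Gedges n → ℝ) (i : Fin n) :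
    vsumR (Gedges n) L (va i) = L (edgeAB i) + L (edgeXA i) := by
  simp [vsumR, sum_Gedges_s1, edgeAB, edgeXA, edgeYB, va, vb, vx, vy]

theorem vsumR_vb {n : ℕ} (L : Gedges n → ℝ) (i : Fin n) :
    vsumR (Gedges n) L (vb i) = L (edgeAB i) + L (edgeYB i) := by
  simp [vsumR, sum_Gedges_s1, edgeAB, edgeXA, edgeYB, va, vb, vx, vy]

theorem vsumR_vx {n : ℕ} (L : Gedges n → ℝ) :
    vsumR (Gedges n) L vx = ∑ i, L (edgeXA i) := by
  simp [vsumR, sum_Gedges_s1, edgeAB, edgeXA, edgeYB, va, vb, vx, vy]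

theorem vsumR_vy {n : ℕ} (L : Gedges n → ℝ) :
    vsumR (Gedges n) L vy = ∑ i, L (edgeYB i) := by
  simp [vsumR, sum_Gedges_s1, edgeAB, edgeXA, edgeYB, va, vb, vx, vy]

theorem Lstar_edgeAB {n : ℕ} (i : Fin n) : Lstar n (edgeAB i) = 1 := by
  simp [Lstar, edgeAB, va, vb, vx, vy]

theorem Lstar_edgeXA {n : ℕ} (i : Fin n) : Lstar n (edgeXA i) = ((n : ℝ) - 1)⁻¹ := by
  simp [Lstar, edgeXA]

theorem Lstar_edgeYB {n : ℕ} (i : Fin n) : Lstar n (edgeYB i) = ((n : ℝ) - 1)⁻¹ := by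
  simp [Lstar, edgeYB]

theorem Lstar_mem_magicPolytope {n : ℕ} (hn : 2 ≤ n) :
    Lstar n ∈ magicPolytope (Gedges n) := by
  have hn' : (1 : ℝ) ≤ (n : ℝ) - 1 := by
    have : (2 : ℝ) ≤ n := by exact_mod_cast hn
    linarith
  have hsum : (n : ℝ) * ((n : ℝ) - 1)⁻¹ = 1 + ((n : ℝ) - 1)⁻¹ := by
    have : (n : ℝ) - 1 ≠ 0 := by linarith
    field_simp
    ring
  refine ⟨fun e => ?_, ?_⟩
  · unfold Lstar
    split_ifs
    · exact ⟨inv_nonneg.2 (by linarith), inv_le_one_of_one_le₀ hn'⟩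
    · norm_num
  · have key : ∀ v, vsumR (Gedges n) (Lstar n) v = 1 + ((n : ℝ) - 1)⁻¹ := by
      rintro (i | i | _ | _)
      · exact (vsumR_va _ i).trans (by rw [Lstar_edgeAB, Lstar_edgeXA])
      · exact (vsumR_vb _ i).trans (by rw [Lstar_edgeAB, Lstar_edgeYB])
      · exact (vsumR_vx _).trans (by simp [Lstar_edgeXA, hsum])
      · exact (vsumR_vy _).trans (by simp [Lstar_edgeYB, hsum])
    intro v w
    rw [key, key]

/-- `Lstar n` is the only point of the polytope with value `1` on every edge `aᵢbᵢ`. -/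
theorem eq_Lstar_of_edgeAB_eq_one {n : ℕ} (hn : 2 ≤ n) {L : Gedges n → ℝ}
    (hL : L ∈ magicPolytope (Gedges n)) (h : ∀ i, L (edgeAB i) = 1) : L = Lstar n := by
  have hn' : (n : ℝ) - 1 ≠ 0 := by
    have : (2 : ℝ) ≤ n := by exact_mod_cast hn
    linarith
  set t := vsumR (Gedges n) L vx with ht
  have hX (i : Fin n) : L (edgeXA i) = t - 1 := by
    have := hL.2 (va i) vx
    rw [vsumR_va, h] at this
    linarith
  have hY (i : Fin n) : L (edgeYB i) = t - 1 := by
    have := hL.2 (vb i) vx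
    rw [vsumR_vb, h] at this
    linarith
  have hval : t - 1 = ((n : ℝ) - 1)⁻¹ := by
    have hsum : t = n * (t - 1) := by
      rw [vsumR_vx] at ht
      simpa only [hX, sum_const, card_univ, Fintype.card_fin, nsmul_eq_mul] using ht
    refine eq_inv_of_mul_eq_one_left ?_
    linarith
  funext e
  rcases Gedges_cases e with ⟨i, rfl⟩ | ⟨i, rfl⟩ | ⟨i, rfl⟩
  · rw [h, Lstar_edgeAB]
  · rw [hX, hval, Lstar_edgeXA]
  · rw [hY, hval, Lstar_edgeYB]

/-- For each `n ≥ 2`, the point assigning `1` to each edge `aᵢbᵢ` and `1/(n-1)` to each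
edge `x aᵢ` and `y bᵢ` is an extreme point of `P_{Gₙ}`. -/
theorem Lstar_extremePoint (n : ℕ) (hn : 2 ≤ n) :
    Lstar n ∈ (magicPolytope (Gedges n)).extremePoints ℝ := by
  refine mem_extremePoints_iff_left.2 ⟨Lstar_mem_magicPolytope hn, ?_⟩
  rintro L₁ h₁ L₂ h₂ ⟨a, b, ha, hb, hab, h⟩
  refine eq_Lstar_of_edgeAB_eq_one hn h₁ fun i => ?_
  have hi := congrFun h (edgeAB i)
  rw [Lstar_edgeAB, Pi.add_apply, Pi.smul_apply, Pi.smul_apply, smul_eq_mul, smul_eq_mul] at hi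
  have hi₁ := (h₁.1 (edgeAB i)).2
  have hi₂ := (h₂.1 (edgeAB i)).2
  nlinarith [mul_le_mul_of_nonneg_left hi₂ hb.le]
end

section
/- For every integer n ≥ 2 and every k ∈ ℕ, the number M_{G_n}(k) of magic k-labelings of G_n satisfies M_{G_n}(k) = C(k + n, n) + F_{n−1}(k), where C(·,·) denotes the binomial coefficient. -/
open Finset

/-- `Fqp n k = ∑ C(j, n)` over `0 ≤ j ≤ k` with `j ≡ k (mod n)`. -/
def Fqp (n k : ℕ) : ℕ :=
  ∑ j ∈ (Finset.range (k + 1)).filter (fun j => j % n = k % n), j.choose n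

/-- The edges of `Gₙ` indexed by `aᵢbᵢ`, `x aᵢ` and `y bᵢ`, in this order. -/
def edgeOfIndex {n : ℕ} : Fin n ⊕ Fin n ⊕ Fin n → Gedges n
  | Sum.inl i => ⟨s(va i, vb i), by simp [Gedges, va, vb, vx, vy]⟩
  | Sum.inr (Sum.inl i) => ⟨s(vx, va i), by simp [Gedges, va, vb, vx, vy]⟩
  | Sum.inr (Sum.inr i) => ⟨s(vy, vb i), by simp [Gedges, va, vb, vx, vy]⟩

lemma edgeOfIndex_bijective (n : ℕ) : Function.Bijective (edgeOfIndex (n := n)) := by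
  constructor
  · rintro (i | i | i) (j | j | j) h <;>
      simp_all [edgeOfIndex, va, vb, vx, vy]
  · rintro ⟨e, he⟩
    simp only [Gedges, mem_union, mem_image, mem_univ, true_and] at he
    rcases he with (⟨i, rfl⟩ | ⟨i, rfl⟩) | ⟨i, rfl⟩
    exacts [⟨Sum.inl i, rfl⟩, ⟨Sum.inr (Sum.inl i), rfl⟩, ⟨Sum.inr (Sum.inr i), rfl⟩]

/-- The indexing of the edges of `Gₙ` as an equivalence. -/
noncomputable def edgeEquiv (n : ℕ) : Fin n ⊕ Fin n ⊕ Fin n ≃ Gedges n :=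
  Equiv.ofBijective edgeOfIndex (edgeOfIndex_bijective n)

lemma vsum_eq_sum_index {n : ℕ} (L : Gedges n → ℕ) (v : Vn n) :
    vsum (Gedges n) L v =
      ∑ t, if v ∈ (edgeOfIndex t).1 then L (edgeOfIndex t) else 0 := by
  rw [vsum, ← univ_eq_attach]
  exact ((edgeEquiv n).sum_comp fun e => if v ∈ e.1 then L e else 0).symm

section VertexSums

variable {n : ℕ} (L : Gedges n → ℕ)

lemma vsum_va (i : Fin n) :
    vsum (Gedges n) L (va i) =
      L (edgeOfIndex (Sum.inl i)) + L (edgeOfIndex (Sum.inr (Sum.inl i))) := by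
  rw [vsum_eq_sum_index]
  simp [edgeOfIndex, va, vb, vx, vy]

lemma vsum_vb (i : Fin n) :
    vsum (Gedges n) L (vb i) =
      L (edgeOfIndex (Sum.inl i)) + L (edgeOfIndex (Sum.inr (Sum.inr i))) := by
  rw [vsum_eq_sum_index]
  simp [edgeOfIndex, va, vb, vx, vy]

lemma vsum_vx :
    vsum (Gedges n) L vx = ∑ i, L (edgeOfIndex (Sum.inr (Sum.inl i))) := by
  rw [vsum_eq_sum_index]
  simp [edgeOfIndex, va, vb, vx, vy]

lemma vsum_vy :
    vsum (Gedges n) L vy = ∑ i, L (edgeOfIndex (Sum.inr (Sum.inr i))) := by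
  rw [vsum_eq_sum_index]
  simp [edgeOfIndex, va, vb, vx, vy]

end VertexSums

/-- Tuples all of whose partial sums omitting one entry are at most `k`. -/
def omitSumLe (n k : ℕ) : Set (Fin n → ℕ) := {p | ∀ i, ∑ j, p j ≤ k + p i}

lemma le_of_mem_omitSumLe {n k : ℕ} (hn : 2 ≤ n) {p : Fin n → ℕ} (hp : p ∈ omitSumLe n k)
    (i : Fin n) : p i ≤ k := by
  have : Nontrivial (Fin n) := Fin.nontrivial_iff_two_le.mpr hn
  obtain ⟨j, hj⟩ := exists_ne i
  have h₁ : ∑ l ∈ {i, j}, p l ≤ ∑ l, p l := sum_le_sum_of_subset (subset_univ _)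
  rw [sum_pair hj.symm] at h₁
  have h₂ := hp j
  omega

lemma omitSumLe_finite {n : ℕ} (hn : 2 ≤ n) (k : ℕ) : (omitSumLe n k).Finite :=
  (Set.Finite.pi fun _ : Fin n => Set.finite_Iic k).subset
    fun _ hp i _ => le_of_mem_omitSumLe hn hp i

/-- The labeling of `Gₙ` with labels `p i` on `x aᵢ` and `y bᵢ`, and complementary labels
on `aᵢbᵢ`. -/
noncomputable def labelingOf {n : ℕ} (p : Fin n → ℕ) (e : Gedges n) : ℕ :=
  Sum.elim (fun i => ∑ j, p j - p i) (Sum.elim p p) ((edgeEquiv n).symm e)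

lemma labelingOf_edgeOfIndex {n : ℕ} (p : Fin n → ℕ) (t : Fin n ⊕ Fin n ⊕ Fin n) :
    labelingOf p (edgeOfIndex t) =
      Sum.elim (fun i => ∑ j, p j - p i) (Sum.elim p p) t :=
  congrArg _ ((edgeEquiv n).symm_apply_apply t)

lemma labelingOf_injective (n : ℕ) : Function.Injective (labelingOf (n := n)) := by
  intro p q h
  ext i
  simpa [labelingOf_edgeOfIndex] using congrFun h (edgeOfIndex (Sum.inr (Sum.inl i)))

lemma isMagic_labelingOf {n : ℕ} (p : Fin n → ℕ) : IsMagic (Gedges n) (labelingOf p) := by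
  suffices h : ∀ v, vsum (Gedges n) (labelingOf p) v = ∑ j, p j from
    fun v w => (h v).trans (h w).symm
  have hp (i : Fin n) : p i ≤ ∑ j, p j := single_le_sum (fun _ _ => Nat.zero_le _) (mem_univ i)
  rintro (i | i | _ | _)
  · refine (vsum_va _ i).trans ?_
    simpa [labelingOf_edgeOfIndex] using Nat.sub_add_cancel (hp i)
  · refine (vsum_vb _ i).trans ?_
    simpa [labelingOf_edgeOfIndex] using Nat.sub_add_cancel (hp i)
  · refine (vsum_vx _).trans ?_
    simp [labelingOf_edgeOfIndex]
  · refine (vsum_vy _).trans ?_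
    simp [labelingOf_edgeOfIndex]

lemma IsMagic.eq_labelingOf {n : ℕ} {L : Gedges n → ℕ} (hL : IsMagic (Gedges n) L) :
    L = labelingOf fun i => L (edgeOfIndex (Sum.inr (Sum.inl i))) := by
  funext e
  obtain ⟨t, rfl⟩ := (edgeOfIndex_bijective n).2 e
  rw [labelingOf_edgeOfIndex]
  rcases t with i | i | i
  · have h := hL (va i) vx
    rw [vsum_va, vsum_vx] at h
    simp only [Sum.elim_inl]
    omega
  · rfl
  · have h := hL (va i) (vb i)
    rw [vsum_va, vsum_vb] at h
    simp only [Sum.elim_inr]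
    omega

lemma labelingOf_le_iff {n k : ℕ} (hn : 2 ≤ n) (p : Fin n → ℕ) :
    (∀ e, labelingOf p e ≤ k) ↔ p ∈ omitSumLe n k := by
  constructor
  · intro h i
    have := h (edgeOfIndex (Sum.inl i))
    simp only [labelingOf_edgeOfIndex, Sum.elim_inl] at this
    omega
  · intro h e
    obtain ⟨t, rfl⟩ := (edgeOfIndex_bijective n).2 e
    rw [labelingOf_edgeOfIndex]
    rcases t with i | i | i
    · have := h i
      simp only [Sum.elim_inl]
      omega
    · exact le_of_mem_omitSumLe hn h i
    · exact le_of_mem_omitSumLe hn h i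

lemma magicCount_Gedges_eq_ncard {n : ℕ} (hn : 2 ≤ n) (k : ℕ) :
    magicCount (Gedges n) k = (omitSumLe n k).ncard := by
  rw [magicCount, ← Set.ncard_image_of_injective _ (labelingOf_injective n)]
  congr 1
  ext L
  constructor
  · rintro ⟨hL, hk⟩
    rw [hL.eq_labelingOf, labelingOf_le_iff hn] at hk
    exact ⟨_, hk, hL.eq_labelingOf.symm⟩
  · rintro ⟨p, hp, rfl⟩
    exact ⟨isMagic_labelingOf p, (labelingOf_le_iff hn p).2 hp⟩

lemma card_piAntidiag_univ_fin (d k : ℕ) :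
    (piAntidiag (univ : Finset (Fin (d + 1))) k).card = (k + d).choose d := by
  rw [← map_sym_eq_piAntidiag, card_map, sym_univ, card_univ, Sym.card_sym_eq_choose,
    Fintype.card_fin, show d + 1 + k - 1 = k + d by omega]
  exact Nat.choose_symm_add

lemma finite_setOf_sum_eq (d k : ℕ) : {p : Fin (d + 1) → ℕ | ∑ j, p j = k}.Finite :=
  (piAntidiag (univ : Finset (Fin (d + 1))) k).finite_toSet.subset
    fun p hp => by simpa using hp

lemma ncard_setOf_sum_eq (d k : ℕ) :
    {p : Fin (d + 1) → ℕ | ∑ j, p j = k}.ncard = (k + d).choose d := by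
  rw [← card_piAntidiag_univ_fin, ← Set.ncard_coe_finset]
  congr 1
  ext p
  simp

lemma ncard_setOf_sum_le (d k : ℕ) :
    {p : Fin (d + 1) → ℕ | ∑ j, p j ≤ k}.ncard = (k + (d + 1)).choose (d + 1) := by
  have h : {p : Fin (d + 1) → ℕ | ∑ j, p j ≤ k} =
      ((range (k + 1)).biUnion fun s => piAntidiag (univ : Finset (Fin (d + 1))) s) := by
    ext p
    simp
  rw [h, Set.ncard_coe_finset, card_biUnion]
  · simp_rw [card_piAntidiag_univ_fin]
    exact Nat.sum_range_add_choose k d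
  · intro a _ b _ hab
    refine disjoint_left.2 ?_
    intro p hp hq
    simp only [mem_piAntidiag] at hp hq
    exact hab (hp.1.symm.trans hq.1)

lemma Fqp_of_lt {d k : ℕ} (h : k < d) : Fqp d k = 0 :=
  sum_eq_zero fun j hj => Nat.choose_eq_zero_of_lt (by
    have := mem_range.1 (mem_filter.1 hj).1
    omega)

lemma Fqp_add_self {d : ℕ} (hd : 0 < d) (k : ℕ) :
    Fqp d (k + d) = Fqp d k + (k + d).choose d := by
  have h : (range (k + d + 1)).filter (fun j => j % d = (k + d) % d) =
      insert (k + d) ((range (k + 1)).filter fun j => j % d = k % d) := by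
    ext j
    simp only [mem_filter, mem_range, mem_insert, Nat.add_mod_right]
    constructor
    · rintro ⟨hj, hm⟩
      by_cases hjk : j ≤ k
      · exact Or.inr ⟨by omega, hm⟩
      · have := Nat.le_of_dvd (by omega) ((Nat.modEq_iff_dvd' (by omega)).1
          (show k ≡ j [MOD d] from hm.symm))
        exact Or.inl (by omega)
    · rintro (rfl | ⟨hj, hm⟩)
      · simp
      · exact ⟨by omega, hm⟩
  rw [Fqp, h, sum_insert (by simp; omega), add_comm, Fqp]

/-- The tuples in `omitSumLe n k` whose total sum exceeds `k`. -/
def omitSumLeLt (n k : ℕ) : Set (Fin n → ℕ) := {p ∈ omitSumLe n k | k < ∑ j, p j}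

lemma omitSumLeLt_of_lt {d k : ℕ} (h : k < d) : omitSumLeLt (d + 1) k = ∅ := by
  refine Set.eq_empty_of_forall_notMem ?_
  rintro p ⟨hp, hk⟩
  have h₀ := hp 0
  have h₁ : ∑ _i : Fin d, 1 ≤ ∑ i : Fin d, p i.succ :=
    sum_le_sum fun i _ => by
      have := hp i.succ
      omega
  rw [Fin.sum_univ_succ] at h₀
  simp only [sum_const, card_univ, Fintype.card_fin, smul_eq_mul, mul_one] at h₁
  omega

lemma omitSumLeLt_add (d k : ℕ) :
    omitSumLeLt (d + 1) (k + d) =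
      (fun p i => p i + 1) '' (omitSumLeLt (d + 1) k ∪ {p | ∑ j, p j = k}) := by
  have hsum (q : Fin (d + 1) → ℕ) : ∑ j, (q j + 1) = ∑ j, q j + (d + 1) := by
    simp [sum_add_distrib]
  ext p
  constructor
  · rintro ⟨hp, hk⟩
    obtain ⟨q, rfl⟩ : ∃ q : Fin (d + 1) → ℕ, (fun i => q i + 1) = p :=
      ⟨fun i => p i - 1, funext fun i => Nat.sub_add_cancel (by
        have := hp i
        omega)⟩
    refine ⟨q, ?_, rfl⟩
    rw [hsum] at hk
    by_cases hq : ∑ j, q j = k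
    · exact Or.inr hq
    · refine Or.inl ⟨fun i => ?_, by omega⟩
      have := hp i
      rw [hsum] at this
      dsimp only at this
      omega
  · rintro ⟨q, hq, rfl⟩
    refine ⟨fun i => ?_, ?_⟩
    · rw [hsum]
      rcases hq with ⟨hq, -⟩ | hq
      · have := hq i
        dsimp only
        omega
      · have : ∑ j, q j = k := hq
        dsimp only
        omega
    · rw [hsum]
      rcases hq with ⟨-, hq⟩ | hq
      · omega
      · have : ∑ j, q j = k := hq
        omega

lemma ncard_omitSumLeLt {d : ℕ} (hd : 0 < d) (k : ℕ) :
    (omitSumLeLt (d + 1) k).ncard = Fqp d k := by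
  induction k using Nat.strong_induction_on with
  | _ k ih =>
    rcases lt_or_ge k d with h | h
    · rw [omitSumLeLt_of_lt h, Fqp_of_lt h, Set.ncard_empty]
    · obtain ⟨k, rfl⟩ := Nat.exists_eq_add_of_le' h
      have hinj : Function.Injective fun (p : Fin (d + 1) → ℕ) i => p i + 1 :=
        fun p q hpq => funext fun i => Nat.succ_injective (congrFun hpq i)
      have hdisj : Disjoint (omitSumLeLt (d + 1) k) {p | ∑ j, p j = k} :=
        Set.disjoint_left.2 fun p hp hq => hp.2.ne' hq
      rw [omitSumLeLt_add, Set.ncard_image_of_injective _ hinj,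
        Set.ncard_union_eq hdisj ((omitSumLe_finite (by omega) k).subset (Set.sep_subset _ _))
          (finite_setOf_sum_eq d k),
        ih k (by omega), ncard_setOf_sum_eq, Fqp_add_self hd]

/-- `M_{Gₙ}(k) = C(k + n, n) + F_{n-1}(k)`. -/
theorem magicCount_Gn_eq_binomial_add_F (n : ℕ) (hn : 2 ≤ n) (k : ℕ) :
    magicCount (Gedges n) k = (k + n).choose n + Fqp (n - 1) k := by
  rw [magicCount_Gedges_eq_ncard hn]
  obtain ⟨d, rfl⟩ : ∃ d, n = d + 1 := ⟨n - 1, by omega⟩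
  have hunion : omitSumLe (d + 1) k = {p | ∑ j, p j ≤ k} ∪ omitSumLeLt (d + 1) k := by
    ext p
    constructor
    · intro hp
      exact (le_or_gt (∑ j, p j) k).imp id fun h => ⟨hp, h⟩
    · rintro (hp | hp)
      · exact fun i => le_add_right hp
      · exact hp.1
  have hfin := omitSumLe_finite hn k
  rw [hunion] at hfin ⊢
  rw [Set.ncard_union_eq (Set.disjoint_left.2 fun p hp hq => hq.2.not_ge hp)
      (hfin.subset Set.subset_union_left) (hfin.subset Set.subset_union_right),
    ncard_setOf_sum_le, ncard_omitSumLeLt (by omega), Nat.add_sub_cancel]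
end

section
/- Let F : ℤ → ℚ be a quasipolynomial. Then the first difference ΔF is also a quasipolynomial, and the minimum quasiperiod of ΔF equals the minimum quasiperiod of F. -/
/-- `F : ℤ → ℚ` is a quasipolynomial with quasiperiod `s`: there are polynomials
`φ_r` for each residue `r` mod `s` with `F t = φ_{t mod s}(t)`. -/
def IsQuasiPolyZ (F : ℤ → ℚ) (s : ℕ) : Prop :=
  0 < s ∧ ∃ φ : ℤ → Polynomial ℚ, ∀ t : ℤ, F t = (φ (t % (s : ℤ))).eval (t : ℚ)

open Polynomial in
/-- Every rational polynomial is the first difference of a rational polynomial. -/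
theorem exists_polynomial_fdiff_eq (p : ℚ[X]) :
    ∃ q : ℚ[X], ∀ x : ℚ, q.eval (x + 1) - q.eval x = p.eval x := by
  induction p using Polynomial.induction_on' with
  | add p₁ p₂ h₁ h₂ =>
    obtain ⟨q₁, h₁⟩ := h₁
    obtain ⟨q₂, h₂⟩ := h₂
    refine ⟨q₁ + q₂, fun x => ?_⟩
    simp only [eval_add, ← h₁, ← h₂]
    ring
  | monomial n a =>
    refine ⟨C (a / (n + 1)) * Polynomial.bernoulli (n + 1), fun x => ?_⟩
    have hn : (n : ℚ) + 1 ≠ 0 := by positivity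
    rw [add_comm x 1]
    simp only [eval_mul, eval_C, Polynomial.bernoulli_eval_one_add, eval_monomial]
    push_cast
    rw [← mul_sub, add_sub_cancel_left]
    field_simp

/-- A function on `ℤ` whose first difference is polynomial is itself polynomial. -/
theorem exists_polynomial_eq_of_fdiff_eq {g : ℤ → ℚ} {p : Polynomial ℚ}
    (h : ∀ k : ℤ, g (k + 1) - g k = p.eval (k : ℚ)) :
    ∃ q : Polynomial ℚ, ∀ k : ℤ, g k = q.eval (k : ℚ) := by
  obtain ⟨q, hq⟩ := exists_polynomial_fdiff_eq p
  refine ⟨q + Polynomial.C (g 0 - q.eval 0), fun k => ?_⟩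
  have step : ∀ k : ℤ, g (k + 1) - q.eval ((k + 1 : ℤ) : ℚ) = g k - q.eval (k : ℚ) := by
    intro k
    have h₁ := h k
    have h₂ := hq k
    push_cast
    linarith
  have const : g k - q.eval (k : ℚ) = g 0 - q.eval 0 := by
    induction k using Int.induction_on with
    | zero => simp
    | succ i ih => rw [step, ih]
    | pred i ih =>
      rw [← step, sub_add_cancel, ih]
  simp only [Polynomial.eval_add, Polynomial.eval_C]
  linarith

/-- `F` has quasiperiod `s` iff its restriction to each progression `r + sℤ` is polynomial. -/
theorem isQuasiPolyZ_iff (F : ℤ → ℚ) (s : ℕ) :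
    IsQuasiPolyZ F s ↔ 0 < s ∧
      ∀ r : ℤ, ∃ p : Polynomial ℚ, ∀ k : ℤ, F (r + s * k) = p.eval (k : ℚ) := by
  refine and_congr_right fun hs => ⟨?_, fun h => ?_⟩
  · rintro ⟨φ, hφ⟩ r
    refine ⟨(φ (r % s)).comp (Polynomial.C (r : ℚ) + Polynomial.C (s : ℚ) * Polynomial.X),
      fun k => ?_⟩
    rw [hφ, Int.add_mul_emod_self_left]
    simp
  · choose p hp using h
    refine ⟨fun r => (p r).comp (Polynomial.C (s : ℚ)⁻¹ *
      (Polynomial.X - Polynomial.C (r : ℚ))), fun t => ?_⟩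
    have hs' : (s : ℚ) ≠ 0 := by positivity
    have ht : (t : ℚ) = ((t % s : ℤ) : ℚ) + s * ((t / s : ℤ) : ℚ) := by
      exact_mod_cast (Int.emod_add_mul_ediv t s).symm
    have hk : (s : ℚ)⁻¹ * ((t : ℚ) - ((t % s : ℤ) : ℚ)) = ((t / s : ℤ) : ℚ) := by
      rw [ht, add_sub_cancel_left, inv_mul_cancel_left₀ hs']
    simp only [Polynomial.eval_comp, Polynomial.eval_mul, Polynomial.eval_sub,
      Polynomial.eval_C, Polynomial.eval_X]
    rw [hk, ← hp, Int.emod_add_mul_ediv]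

/-- A function on `ℤ` and its first difference have the same quasiperiods. -/
theorem isQuasiPolyZ_fdiff_iff (F : ℤ → ℚ) (s : ℕ) :
    IsQuasiPolyZ (fun t => F (t + 1) - F t) s ↔ IsQuasiPolyZ F s := by
  simp only [isQuasiPolyZ_iff]
  refine and_congr_right fun _ => ⟨fun h r => ?_, fun h r => ?_⟩
  · choose p hp using h
    refine exists_polynomial_eq_of_fdiff_eq (g := fun k => F (r + s * k))
      (p := ∑ i ∈ Finset.range s, p (r + i)) fun k => ?_
    rw [Polynomial.eval_finsetSum]
    have tel := Finset.sum_range_sub (fun i : ℕ => F (r + s * k + i)) s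
    simp only [Nat.cast_zero, add_zero] at tel
    rw [show r + (s : ℤ) * (k + 1) = r + s * k + s by ring, ← tel]
    refine Finset.sum_congr rfl fun i _ => ?_
    rw [← hp, add_right_comm r (i : ℤ), Nat.cast_succ, add_assoc _ (i : ℤ) 1]
  · obtain ⟨p, hp⟩ := h r
    obtain ⟨q, hq⟩ := h (r + 1)
    refine ⟨q - p, fun k => ?_⟩
    rw [Polynomial.eval_sub, ← hp, ← hq, add_right_comm]

/-- If `F : ℤ → ℚ` is a quasipolynomial, then so is its first difference
`ΔF(t) = F(t+1) - F(t)`, and the minimum quasiperiods of `F` and `ΔF` coincide. -/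
theorem fdiff_quasipolynomial_same_min_quasiperiod (F : ℤ → ℚ)
    (hF : ∃ s, IsQuasiPolyZ F s) :
    (∃ s, IsQuasiPolyZ (fun t => F (t + 1) - F t) s) ∧
    ∀ m : ℕ, IsLeast {s : ℕ | IsQuasiPolyZ F s} m ↔
      IsLeast {s : ℕ | IsQuasiPolyZ (fun t => F (t + 1) - F t) s} m := by
  simpa only [isQuasiPolyZ_fdiff_iff, iff_self, implies_true, and_true] using hF
end

section
/- Let d ≥ 0 and let f : ℤ → ℚ be given by f(t) = ∑_{i=0}^{d} c_i(t)·t^i, where each c_i : ℤ → ℚ is a periodic function with minimum period s_i. Define F(t) = ∑_{x=0}^{t−1} f(x) for integers t ≥ 1. Then there exist periodic functions C_0, C_1, …, C_{d+1} : ℤ → ℚ such that F(t) = ∑_{i=0}^{d+1} C_i(t)·t^i for all t ≥ 1, the minimum period of C_i divides lcm{s_i, s_{i+1}, …, s_d} for each 0 ≤ i ≤ d, and C_{d+1} is a constant function. -/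
open Finset

/-- Every function on `ℤ` has an antidifference. -/
theorem exists_antidifference (u : ℤ → ℚ) : ∃ h : ℤ → ℚ, ∀ t, h (t + 1) - h t = u t := by
  refine ⟨fun t => ∑ k ∈ Finset.range t.toNat, u k -
    ∑ k ∈ Finset.range (-t).toNat, u (-(k + 1 : ℤ)), fun t => ?_⟩
  rcases le_or_gt 0 t with ht | ht
  · obtain ⟨n, rfl⟩ := Int.eq_ofNat_of_zero_le ht
    have h₁ : ((n : ℤ) + 1).toNat = n + 1 := by omega
    have h₂ : (-((n : ℤ) + 1)).toNat = 0 := by omega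
    have h₃ : (-(n : ℤ)).toNat = 0 := by omega
    simp only [h₁, h₂, h₃, Int.toNat_natCast, Finset.sum_range_succ, Finset.sum_range_zero]
    ring
  · obtain ⟨n, rfl⟩ : ∃ n : ℕ, t = -(n + 1 : ℤ) := ⟨(-t - 1).toNat, by omega⟩
    have h₁ : (-(n + 1 : ℤ) + 1).toNat = 0 := by omega
    have h₂ : (-(-(n + 1 : ℤ) + 1)).toNat = n := by omega
    have h₃ : (-(n + 1 : ℤ)).toNat = 0 := by omega
    have h₄ : (-(-(n + 1 : ℤ))).toNat = n + 1 := by omega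
    simp only [h₁, h₂, h₃, h₄, Finset.sum_range_succ, Finset.sum_range_zero]
    ring

theorem eq_apply_zero_of_forall_add_one_eq {g : ℤ → ℚ} (hg : ∀ t, g (t + 1) = g t) (t : ℤ) :
    g t = g 0 := by
  have h : Function.Periodic g 1 := hg
  simpa using h.int_mul_eq t

/-- A periodic function is a constant plus the difference of a function of the same period. -/
theorem Function.Periodic.exists_antidifference {u : ℤ → ℚ} {L : ℕ} (hL : 0 < L)
    (hu : Function.Periodic u (L : ℤ)) :
    ∃ (h : ℤ → ℚ) (q : ℚ), Function.Periodic h (L : ℤ) ∧ ∀ t, h (t + 1) - h t = u t - q := by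
  obtain ⟨h, hh⟩ := _root_.exists_antidifference u
  have hconst := eq_apply_zero_of_forall_add_one_eq (g := fun t => h (t + L) - h t) fun t => by
    have h₁ := hh t
    have h₂ := hh (t + L)
    rw [hu t] at h₂
    rw [add_right_comm]
    linarith
  have hL' : (L : ℚ) ≠ 0 := by positivity
  refine ⟨fun t => h t - (h (0 + L) - h 0) / L * t, (h (0 + L) - h 0) / L, fun t => ?_,
    fun t => ?_⟩
  · have := hconst t
    push_cast
    rw [← this]
    field_simp
    ring
  · rw [← hh t]
    push_cast
    ring

theorem add_one_pow_eq_sum_add (x : ℚ) (n : ℕ) :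
    (x + 1) ^ n = ∑ i ∈ Finset.range n, (n.choose i : ℚ) * x ^ i + x ^ n := by
  rw [add_pow, Finset.sum_range_succ]
  simp [mul_comm]

/-- A quasi-polynomial whose coefficients have periods `L 0, …, L (n - 1)`, each divisible by the
following ones, has a quasi-polynomial antidifference whose coefficients have the same periods,
up to a new constant leading coefficient. -/
theorem exists_quasipolynomial_antidifference (n : ℕ) (L : ℕ → ℕ) (hpos : ∀ i < n, 0 < L i)
    (hdvd : ∀ i j, i ≤ j → j < n → L j ∣ L i) (c : ℕ → ℤ → ℚ)
    (hc : ∀ i < n, Function.Periodic (c i) (L i : ℤ)) :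
    ∃ C : ℕ → ℤ → ℚ, (∀ i < n, Function.Periodic (C i) (L i : ℤ)) ∧
      (∃ q : ℚ, ∀ t, C n t = q) ∧
      ∀ t : ℤ, ∑ i ∈ Finset.range (n + 1), C i (t + 1) * ((t : ℚ) + 1) ^ i -
        ∑ i ∈ Finset.range (n + 1), C i t * (t : ℚ) ^ i =
        ∑ i ∈ Finset.range n, c i t * (t : ℚ) ^ i := by
  induction n generalizing c with
  | zero => exact ⟨fun _ _ => 0, by simp, ⟨0, fun _ => rfl⟩, by simp⟩
  | succ n ih =>
    obtain ⟨h, q, hper, hdiff⟩ :=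
      (hc n n.lt_succ_self).exists_antidifference (hpos n n.lt_succ_self)
    obtain ⟨C, hC, ⟨r, hr⟩, hCdiff⟩ := ih (fun i hi => hpos i (by omega))
      (fun i j hij hj => hdvd i j hij (by omega))
      (fun i t => c i t - h (t + 1) * n.choose i - q / (n + 1) * (n + 1).choose i)
      (fun i hi t => by
        obtain ⟨k, hk⟩ := hdvd i n hi.le n.lt_succ_self
        have hper' : h (t + L i + 1) = h (t + 1) := by
          rw [add_right_comm, hk, Nat.cast_mul, mul_comm]
          exact hper.nat_mul k _
        simp only [hc i (by omega) t, hper'])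
    refine ⟨fun i t => if i < n then C i t else if i = n then h t + r else q / (n + 1),
      fun i hi t => ?_, ⟨q / (n + 1), fun t => by simp⟩, fun t => ?_⟩
    · rcases Nat.lt_succ_iff_lt_or_eq.mp hi with hi' | rfl
      · simp only [if_pos hi', hC i hi' t]
      · simp [hper t]
    · have hlow : ∀ t : ℤ, ∀ x : ℚ, ∑ i ∈ Finset.range n,
          (if i < n then C i t else if i = n then h t + r else q / (n + 1)) * x ^ i =
          ∑ i ∈ Finset.range n, C i t * x ^ i := fun t x =>
        Finset.sum_congr rfl fun i hi => by rw [if_pos (Finset.mem_range.mp hi)]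
      have key := hCdiff t
      have hn := add_one_pow_eq_sum_add (t : ℚ) n
      have hn' := add_one_pow_eq_sum_add (t : ℚ) (n + 1)
      simp only [Finset.sum_range_succ, sub_mul, Finset.sum_sub_distrib, mul_assoc,
        ← Finset.mul_sum, hr, Nat.choose_succ_self_right] at key hn'
      push_cast at hn'
      simp only [Finset.sum_range_succ, hlow, lt_irrefl, if_true, if_false,
        Nat.not_succ_lt_self, Nat.succ_ne_self]
      have hq : q / ((n : ℚ) + 1) * (n + 1) = q := div_mul_cancel₀ _ (by positivity)
      linear_combination key + h (t + 1) * hn + q / ((n : ℚ) + 1) * hn' +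
        (t : ℚ) ^ n * hdiff t + (t : ℚ) ^ n * hq

/-- The minimum period of a function divides each of its positive periods. -/
theorem Function.Periodic.dvd_of_isLeast {u : ℤ → ℚ} {m L : ℕ}
    (hm : IsLeast {m' : ℕ | 0 < m' ∧ Function.Periodic u (m' : ℤ)} m)
    (hL : Function.Periodic u (L : ℤ)) : m ∣ L := by
  obtain ⟨⟨hm0, hmp⟩, hmin⟩ := hm
  by_contra hdvd
  have hmod : L % m ∈ {m' : ℕ | 0 < m' ∧ Function.Periodic u (m' : ℤ)} := by
    refine ⟨Nat.pos_of_ne_zero fun h => hdvd (Nat.dvd_of_mod_eq_zero h), ?_⟩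
    have h := hL.sub_period (hmp.nat_mul (L / m))
    have e : (L : ℤ) - ((L / m : ℕ) : ℤ) * m = ((L % m : ℕ) : ℤ) := by
      have := Nat.mod_add_div' L m
      zify at this ⊢
      linarith
    rwa [e] at h
  exact absurd (hmin hmod) (Nat.mod_lt L hm0).not_ge

theorem Function.Periodic.exists_isLeast_dvd {u : ℤ → ℚ} {L : ℕ} (hpos : 0 < L)
    (hL : Function.Periodic u (L : ℤ)) :
    ∃ m : ℕ, IsLeast {m' : ℕ | 0 < m' ∧ Function.Periodic u (m' : ℤ)} m ∧ m ∣ L := by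
  have hne : {m' : ℕ | 0 < m' ∧ Function.Periodic u (m' : ℤ)}.Nonempty := ⟨L, hpos, hL⟩
  have hm : IsLeast _ _ := ⟨Nat.sInf_mem hne, fun _ hk => Nat.sInf_le hk⟩
  exact ⟨_, hm, hL.dvd_of_isLeast hm⟩

/-- Sam–Woods: if `f(t) = ∑_{i=0}^d cᵢ(t) tⁱ` with each `cᵢ` periodic of minimum
period `sᵢ`, then `F(t) = ∑_{x=0}^{t-1} f(x)` can be written as
`∑_{i=0}^{d+1} Cᵢ(t) tⁱ` with each `Cᵢ` periodic, the minimum period of `Cᵢ` dividing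
`lcm {sᵢ, …, s_d}` for `i ≤ d`, and `C_{d+1}` constant. -/
theorem sam_woods_antidifference (d : ℕ) (c : ℕ → ℤ → ℚ) (s : ℕ → ℕ) (f : ℤ → ℚ)
    (hf : ∀ t : ℤ, f t = ∑ i ∈ Finset.range (d + 1), c i t * (t : ℚ) ^ i)
    (hs : ∀ i ≤ d, IsLeast {m : ℕ | 0 < m ∧ Function.Periodic (c i) (m : ℤ)} (s i)) :
    ∃ C : ℕ → ℤ → ℚ,
      (∀ t : ℤ, 1 ≤ t → ∑ x ∈ Finset.range t.toNat, f (x : ℤ) =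
        ∑ i ∈ Finset.range (d + 2), C i t * (t : ℚ) ^ i) ∧
      (∀ i ≤ d, ∃ m : ℕ,
        IsLeast {m' : ℕ | 0 < m' ∧ Function.Periodic (C i) (m' : ℤ)} m ∧
        m ∣ (Finset.Icc i d).lcm s) ∧
      (∃ q : ℚ, ∀ t : ℤ, C (d + 1) t = q) := by
  have hpos : ∀ i, 0 < (Finset.Icc i d).lcm s := fun i => Nat.pos_of_ne_zero fun h => by
    obtain ⟨j, hj, hj0⟩ := Finset.lcm_eq_zero_iff.mp h
    exact (hs j (Finset.mem_Icc.mp hj).2).1.1.ne' hj0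
  obtain ⟨C, hC, ⟨q, hq⟩, hdiff⟩ := exists_quasipolynomial_antidifference (d + 1)
    (fun i => (Finset.Icc i d).lcm s)
    (fun i _ => hpos i)
    (fun i j hij _ => Finset.lcm_mono (Finset.Icc_subset_Icc_left hij)) c
    (fun i hi => by
      have hid : i ≤ d := by omega
      obtain ⟨k, hk⟩ : s i ∣ (Finset.Icc i d).lcm s :=
        Finset.dvd_lcm (Finset.mem_Icc.mpr ⟨le_rfl, hid⟩)
      rw [hk, Nat.cast_mul, mul_comm]
      exact (hs i hid).1.2.nat_mul k)
  have hsum : ∀ n : ℕ, ∑ x ∈ Finset.range n, f (x : ℤ) =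
      ∑ i ∈ Finset.range (d + 2), C i n * (n : ℚ) ^ i - C 0 0 := fun n => by
    induction n with
    | zero => simp [Finset.sum_range_succ']
    | succ n ih =>
      have h := hdiff n
      rw [← hf] at h
      push_cast at h ⊢
      rw [Finset.sum_range_succ, ih, ← h]
      ring
  refine ⟨fun i t => if i = 0 then C 0 t - C 0 0 else C i t, fun t ht => ?_, fun i hi => ?_,
    ⟨q, fun t => by simp [hq]⟩⟩
  · lift t to ℕ using by omega
    rw [Int.toNat_natCast, hsum, Finset.sum_range_succ', Finset.sum_range_succ' _ (d + 1)]
    simp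
    ring
  · refine Function.Periodic.exists_isLeast_dvd (hpos i) fun t => ?_
    have h := hC i (by omega) t
    rcases eq_or_ne i 0 with rfl | hi0
    · simpa using h
    · simpa [hi0] using h
end

section
/- Let n and i be integers with 0 ≤ i ≤ n and n ≥ 1. Then for every t ∈ ℕ, the i-th difference of F_n satisfies Δ^i F_n(t) = ∑ C(j, n−i), the sum over all integers j with 0 ≤ j ≤ t and j ≡ t (mod n), where C(·,·) denotes the binomial coefficient. -/
open Finset

/-- The first difference operator on functions `ℕ → ℚ`. -/
def fdiff (F : ℕ → ℚ) : ℕ → ℚ := fun t => F (t + 1) - F t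

/-- Pascal's rule summed over a residue class: the first difference lowers the lower index of the
binomial coefficients by one. -/
theorem fdiff_sum_choose_succ (n m : ℕ) :
    fdiff (fun t => ∑ j ∈ (Finset.range (t + 1)).filter (fun j => j % n = t % n),
        (j.choose (m + 1) : ℚ)) =
      fun t => ∑ j ∈ (Finset.range (t + 1)).filter (fun j => j % n = t % n),
        (j.choose m : ℚ) := by
  funext t
  have hmod (j : ℕ) : (j + 1) % n = (t + 1) % n ↔ j % n = t % n :=
    ⟨fun h => Nat.ModEq.add_right_cancel' 1 h, fun h => Nat.ModEq.add_right 1 h⟩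
  simp only [fdiff, Finset.sum_filter]
  rw [Finset.sum_range_succ' _ (t + 1)]
  simp only [hmod, Nat.choose_zero_succ, Nat.cast_zero, ite_self, add_zero]
  rw [← Finset.sum_sub_distrib]
  refine Finset.sum_congr rfl fun j _ => ?_
  split_ifs
  · rw [Nat.choose_succ_succ', Nat.cast_add, add_sub_cancel_right]
  · exact sub_zero 0

/-- For `0 ≤ i ≤ n`, the `i`-th difference of `Fₙ` satisfies
`Δⁱ Fₙ (t) = ∑ C(j, n - i)` over `0 ≤ j ≤ t` with `j ≡ t (mod n)`. -/
theorem iterated_difference_Fn (n i : ℕ) (hn : 1 ≤ n) (hi : i ≤ n) (t : ℕ) :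
    (fdiff^[i] (fun k => (Fqp n k : ℚ))) t =
      ∑ j ∈ (Finset.range (t + 1)).filter (fun j => j % n = t % n),
        ((j.choose (n - i) : ℚ)) := by
  induction i generalizing t with
  | zero => simp [Fqp]
  | succ i ih =>
    rw [Function.iterate_succ_apply', funext fun s => ih (by omega) s,
      show n - i = n - (i + 1) + 1 by omega, fdiff_sum_choose_succ]
end

section
/- For every integer n ≥ 1, the function F_n is a quasipolynomial whose minimum quasiperiod is exactly n. -/
open Finset

/-- Every polynomial over `ℚ` is the `h`-step difference of a polynomial of degree at most one
more. -/
theorem exists_eval_add_sub_eval_eq (f : Polynomial ℚ) {h : ℚ} (hh : h ≠ 0) :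
    ∃ P : Polynomial ℚ, P.natDegree ≤ f.natDegree + 1 ∧
      ∀ x : ℚ, P.eval (x + h) - P.eval x = f.eval x := by
  refine ⟨∑ k ∈ range (f.natDegree + 1), Polynomial.C (f.coeff k * h ^ k / (k + 1)) *
    (Polynomial.bernoulli (k + 1)).comp (Polynomial.C h⁻¹ * Polynomial.X), ?_, fun x => ?_⟩
  · refine Polynomial.natDegree_sum_le_of_forall_le _ _ fun k hk => ?_
    have hb : (Polynomial.bernoulli (k + 1)).natDegree ≤ k + 1 := by
      refine Polynomial.natDegree_le_iff_coeff_eq_zero.2 fun i hi => ?_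
      rw [Polynomial.coeff_bernoulli, if_neg (by omega)]
    have hk' := mem_range.1 hk
    refine (Polynomial.natDegree_C_mul_le _ _).trans ?_
    rw [Polynomial.natDegree_comp, Polynomial.natDegree_C_mul_X _ (inv_ne_zero hh)]
    omega
  · rw [Polynomial.eval_finsetSum, Polynomial.eval_finsetSum, ← sum_sub_distrib,
      Polynomial.eval_eq_sum_range]
    refine sum_congr rfl fun k _ => ?_
    have hx : h⁻¹ * (x + h) = 1 + h⁻¹ * x := by field_simp; ring
    have hk : (k : ℚ) + 1 ≠ 0 := by positivity
    simp only [Polynomial.eval_mul, Polynomial.eval_C, Polynomial.eval_comp, Polynomial.eval_X, hx,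
      Polynomial.bernoulli_eval_one_add, Nat.add_sub_cancel, mul_pow, inv_pow]
    push_cast
    field_simp
    ring

theorem exists_eval_sub_eval_sub_eq_choose {n : ℕ} (hn : n ≠ 0) :
    ∃ P : Polynomial ℚ, P.natDegree ≤ n + 1 ∧
      ∀ t : ℕ, P.eval (t : ℚ) - P.eval ((t : ℚ) - n) = t.choose n := by
  have hn' : (n : ℚ) ≠ 0 := Nat.cast_ne_zero.2 hn
  obtain ⟨P, hP, h⟩ := exists_eval_add_sub_eval_eq
    (Polynomial.C (n.factorial : ℚ)⁻¹ * Polynomial.taylor (n : ℚ) (descPochhammer ℚ n)) hn'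
  refine ⟨P, hP.trans (Nat.succ_le_succ ((Polynomial.natDegree_C_mul_le _ _).trans ?_)),
    fun t => ?_⟩
  · rw [Polynomial.natDegree_taylor, descPochhammer_natDegree]
  · have ht := h ((t : ℚ) - n)
    rw [sub_add_cancel, Polynomial.eval_mul, Polynomial.eval_C, Polynomial.taylor_eval,
      sub_add_cancel] at ht
    rw [ht, Nat.cast_choose_eq_descPochhammer_div, inv_mul_eq_div]

theorem Polynomial.natDegree_taylor_sub_self_le {R : Type*} [CommRing R] {P : Polynomial R} {m : ℕ}
    (hP : P.natDegree ≤ m + 1) (r : R) : (Polynomial.taylor r P - P).natDegree ≤ m := by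
  refine Polynomial.natDegree_le_iff_coeff_eq_zero.2 fun i hi => ?_
  rw [Polynomial.coeff_sub, sub_eq_zero]
  rcases (show P.natDegree ≤ i by omega).eq_or_lt with h | h
  · rw [← h, Polynomial.coeff_taylor_natDegree, Polynomial.leadingCoeff]
  · rw [Polynomial.coeff_eq_zero_of_natDegree_lt h, Polynomial.coeff_eq_zero_of_natDegree_lt]
    rwa [Polynomial.natDegree_taylor]

theorem Fqp_of_lt_s11 {n t : ℕ} (ht : t < n) : Fqp n t = 0 := by
  refine sum_eq_zero fun j hj => Nat.choose_eq_zero_of_lt ?_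
  have := mem_range.1 (mem_filter.1 hj).1
  omega

theorem Fqp_add_self_s11 {n : ℕ} (hn : n ≠ 0) (t : ℕ) :
    Fqp n (t + n) = Fqp n t + (t + n).choose n := by
  have hs : (range (t + n + 1)).filter (fun j => j % n = (t + n) % n) =
      insert (t + n) ((range (t + 1)).filter (fun j => j % n = t % n)) := by
    ext j
    simp only [mem_filter, mem_range, mem_insert, Nat.add_mod_right]
    constructor
    · rintro ⟨hj, hm⟩
      by_cases h : j < t + 1
      · exact Or.inr ⟨h, hm⟩
      · left
        obtain ⟨c, hc⟩ := (Nat.modEq_iff_dvd' (by omega : t ≤ j)).1 (Eq.symm hm)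
        have hc1 : c = 1 := by
          have h1 : c < 2 := by
            by_contra! h2
            have := Nat.mul_le_mul_left n h2
            omega
          have h0 : c ≠ 0 := by
            rintro rfl
            omega
          omega
        subst hc1
        omega
    · rintro (rfl | ⟨hj, hm⟩)
      · exact ⟨by omega, Nat.add_mod_right _ _⟩
      · exact ⟨by omega, hm⟩
  rw [Fqp, hs, sum_insert (by simp only [mem_filter, mem_range]; omega), add_comm, Fqp]

theorem Fqp_eq_eval_sub_eval_mod {n : ℕ} (hn : n ≠ 0) {P : Polynomial ℚ}
    (hP : ∀ t : ℕ, P.eval (t : ℚ) - P.eval ((t : ℚ) - n) = t.choose n) (t : ℕ) :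
    (Fqp n t : ℚ) = P.eval (t : ℚ) - P.eval ((t % n : ℕ) : ℚ) := by
  induction t using Nat.strong_induction_on with
  | _ t ih =>
    rcases lt_or_ge t n with h | h
    · rw [Fqp_of_lt_s11 h, Nat.mod_eq_of_lt h, sub_self, Nat.cast_zero]
    · obtain ⟨u, rfl⟩ := Nat.exists_eq_add_of_le' h
      have hu := hP (u + n)
      rw [Nat.cast_add, add_sub_cancel_right] at hu
      rw [Fqp_add_self_s11 hn, Nat.cast_add, ih u (by omega), Nat.add_mod_right, Nat.cast_add, ← hu]
      ring

/-- For every `n ≥ 1`, the function `Fₙ` is a quasipolynomial with minimum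
quasiperiod exactly `n`. -/
theorem Fn_minimum_quasiperiod (n : ℕ) (hn : 1 ≤ n) :
    IsLeast {s : ℕ | IsQuasiPoly (fun k => (Fqp n k : ℚ)) s} n := by
  have hn0 : n ≠ 0 := by omega
  obtain ⟨P, hdeg, hP⟩ := exists_eval_sub_eval_sub_eq_choose hn0
  have hF := Fqp_eq_eval_sub_eval_mod hn0 hP
  refine ⟨⟨hn, fun r => P - Polynomial.C (P.eval ((r : ℕ) : ℚ)), fun t => ?_⟩, ?_⟩
  · simpa using hF t
  rintro s ⟨hs, φ, hφ⟩
  by_contra! hsn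
  have hφP (t : ℕ) : φ (t % s) = P - Polynomial.C (P.eval ((t % n : ℕ) : ℚ)) := by
    refine Polynomial.eq_of_infinite_eval_eq _ _ (Set.infinite_of_injective_forall_mem
      (f := fun k : ℕ => ((t + s * n * k : ℕ) : ℚ)) (fun a b hab => ?_) fun k => ?_)
    · have hab' : s * n * a = s * n * b := Nat.add_left_cancel (Nat.cast_injective hab)
      exact Nat.eq_of_mul_eq_mul_left (Nat.mul_pos hs hn) hab'
    · have h1 := hφ (t + s * n * k)
      have h2 := hF (t + s * n * k)
      have h3 : (t + s * n * k) % s = t % s := by rw [mul_assoc, Nat.add_mul_mod_self_left]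
      have h4 : (t + s * n * k) % n = t % n := by
        rw [mul_comm s n, mul_assoc, Nat.add_mul_mod_self_left]
      rw [h3] at h1
      rw [h4] at h2
      simp only [Set.mem_ofPred_eq, Polynomial.eval_sub, Polynomial.eval_C]
      exact h1.symm.trans h2
  have hper (t : ℕ) : P.eval (((t + s) % n : ℕ) : ℚ) = P.eval ((t % n : ℕ) : ℚ) := by
    have h := hφP (t + s)
    rw [Nat.add_mod_right, hφP t] at h
    exact (Polynomial.C_injective (sub_right_injective h)).symm
  have hmod (t : ℕ) (ht : t < 2 * n) : P.eval ((t : ℚ) - n) = P.eval ((t % n : ℕ) : ℚ) := by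
    rcases lt_or_ge t n with h | h
    · have := hP t
      rw [Nat.choose_eq_zero_of_lt h, Nat.cast_zero, sub_eq_zero] at this
      rw [Nat.mod_eq_of_lt h, this]
    · rw [Nat.mod_eq_sub_mod h, Nat.mod_eq_of_lt (by omega), Nat.cast_sub h]
  have hzero : Polynomial.taylor (s : ℚ) P - P = 0 := by
    refine Polynomial.eq_zero_of_natDegree_lt_card_of_eval_eq_zero _
      (f := fun t : Fin (2 * n - s) => ((t : ℕ) : ℚ) - n) (fun a b hab => ?_) (fun t => ?_) ?_
    · exact Fin.ext (Nat.cast_injective (sub_left_injective hab))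
    · have ht := t.2
      have h := hmod (t + s) (by omega)
      rw [hper, ← hmod t (by omega), Nat.cast_add, add_sub_right_comm] at h
      rw [Polynomial.eval_sub, Polynomial.taylor_eval, h, sub_self]
    · have := Polynomial.natDegree_taylor_sub_self_le hdeg (s : ℚ)
      rw [Fintype.card_fin]
      omega
  have hshift (x : ℚ) : P.eval (x + s) = P.eval x := by
    rw [← Polynomial.taylor_eval, sub_eq_zero.1 hzero]
  have h1 := hP n
  have h2 := hP (n - s)
  rw [Nat.choose_eq_zero_of_lt (by omega), Nat.cast_sub hsn.le, ← hshift, ← hshift (_ - _),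
    sub_add_cancel, sub_right_comm, sub_add_cancel, h1, Nat.choose_self] at h2
  norm_num at h2
end

section
/- Let G be a graph and suppose there is an edge e of G such that L(e) = max(L) for every magic labeling L of G of index 2. Then the function M_G : ℕ → ℕ is a quasipolynomial admitting 2 as a quasiperiod. -/
open Finset

/-- The maximum label of a labeling. -/
def maxLabel {V : Type} (E : Finset (Sym2 V)) (L : E → ℕ) : ℕ :=
  E.attach.sup L

/-- A graph is bipartite if the vertices split into a set and its complement with
every edge joining the two parts. -/
def IsBipartite {V : Type} (E : Finset (Sym2 V)) : Prop :=
  ∃ S : Set V, ∀ e ∈ E, ∃ u v : V, e = s(u, v) ∧ u ∈ S ∧ v ∉ S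

/-! ### Quasipolynomials of quasiperiod two -/

/-- From `a` on, `f` agrees with a quasipolynomial of quasiperiod `2`. -/
def IsQuasiPolyTwoFrom (f : ℕ → ℕ) (a : ℕ) : Prop :=
  ∃ φ : ℕ → Polynomial ℚ, ∀ t, a ≤ t → (f t : ℚ) = (φ (t % 2)).eval (t : ℚ)

lemma Polynomial.exists_eval_add_two_sub_eval (p : Polynomial ℚ) :
    ∃ q : Polynomial ℚ, ∀ x, q.eval (x + 2) - q.eval x = p.eval x := by
  induction p using Polynomial.induction_on' with
  | add p₁ p₂ h₁ h₂ =>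
    obtain ⟨q₁, h₁⟩ := h₁
    obtain ⟨q₂, h₂⟩ := h₂
    refine ⟨q₁ + q₂, fun x => ?_⟩
    rw [Polynomial.eval_add, Polynomial.eval_add, Polynomial.eval_add, ← h₁, ← h₂]
    ring
  | monomial n a =>
    refine ⟨Polynomial.C (a * 2 ^ n / (n + 1)) *
      (Polynomial.bernoulli (n + 1)).comp (Polynomial.C (1 / 2) * Polynomial.X), fun x => ?_⟩
    have h := Polynomial.bernoulli_eval_one_add (n + 1) (x / 2)
    have hx : 1 / 2 * (x + 2) = 1 + x / 2 := by ring
    have hx' : 1 / 2 * x = x / 2 := by ring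
    have hn : (n : ℚ) + 1 ≠ 0 := by positivity
    simp only [Polynomial.eval_mul, Polynomial.eval_comp, Polynomial.eval_C, Polynomial.eval_X,
      Polynomial.eval_monomial, hx, hx', h]
    push_cast
    rw [div_pow]
    field_simp
    ring

lemma IsQuasiPolyTwoFrom.of_add_two {f g : ℕ → ℕ} {a : ℕ}
    (hg : IsQuasiPolyTwoFrom g (a + 2)) (h : ∀ t, f (t + 2) = g (t + 2) + f t) :
    IsQuasiPolyTwoFrom f a := by
  obtain ⟨φ, hφ⟩ := hg
  choose ψ hψ using fun r : ℕ => Polynomial.exists_eval_add_two_sub_eval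
    ((φ r).comp (Polynomial.X + Polynomial.C 2))
  have key : ∀ n r, a ≤ r → (f (r + 2 * n) : ℚ) - (ψ (r % 2)).eval ((r + 2 * n : ℕ) : ℚ) =
      f r - (ψ (r % 2)).eval (r : ℚ) := by
    intro n r hr
    induction n with
    | zero => simp
    | succ n ih =>
      have h1 := h (r + 2 * n)
      have h2 := hφ (r + 2 * n + 2) (by omega)
      have h3 := hψ (r % 2) ((r + 2 * n : ℕ) : ℚ)
      rw [show (r + 2 * n + 2) % 2 = r % 2 by omega] at h2
      rw [Polynomial.eval_comp] at h3
      simp only [Polynomial.eval_add, Polynomial.eval_X, Polynomial.eval_C] at h3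
      rw [show r + 2 * (n + 1) = r + 2 * n + 2 by ring, h1]
      push_cast at *
      linarith
  let b : ℕ → ℕ := fun r => if a % 2 = r then a else a + 1
  refine ⟨fun r => ψ r + Polynomial.C ((f (b r) : ℚ) - (ψ r).eval (b r : ℚ)), fun t ht => ?_⟩
  have hb : a ≤ b (t % 2) ∧ b (t % 2) % 2 = t % 2 ∧ b (t % 2) ≤ t := by
    simp only [b]
    split_ifs <;> omega
  obtain ⟨hb1, hb2, hb3⟩ := hb
  have := key ((t - b (t % 2)) / 2) (b (t % 2)) hb1
  rw [show b (t % 2) + 2 * ((t - b (t % 2)) / 2) = t by omega, hb2] at this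
  simp only [Polynomial.eval_add, Polynomial.eval_C]
  linarith

lemma IsQuasiPolyTwoFrom.sum {ι : Type*} {s : Finset ι} {f : ι → ℕ → ℕ} {a : ℕ}
    (h : ∀ i ∈ s, IsQuasiPolyTwoFrom (f i) a) :
    IsQuasiPolyTwoFrom (fun t => ∑ i ∈ s, f i t) a := by
  choose! φ hφ using h
  refine ⟨fun r => ∑ i ∈ s, φ i r, fun t ht => ?_⟩
  rw [Polynomial.eval_finsetSum]
  push_cast
  exact Finset.sum_congr rfl fun i hi => hφ i hi t ht

lemma finite_setOf_le {α : Type*} [Finite α] (k : ℕ) : {L : α → ℕ | ∀ x, L x ≤ k}.Finite :=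
  (Set.Finite.pi' fun _ : α => Set.finite_Iic k).subset fun _ hL => hL

/-! ### Lattice points in simplicial cones -/

section Cone

variable {α : Type}

/-- Lattice points with entries at most `k` in the open cone spanned by the vectors `v i`, with the
coefficients indexed by `T` bounded by `1`. -/
def simplicialPoints {ι : Type} [Fintype ι] (v : ι → α → ℕ) (T : Finset ι) (k : ℕ) :
    Set (α → ℕ) :=
  {L | (∀ x, L x ≤ k) ∧ ∃ c : ι → ℚ, (∀ i, 0 < c i) ∧ (∀ i ∈ T, c i ≤ 1) ∧
    ∀ x, (L x : ℚ) = ∑ i, c i * v i x}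

lemma ncard_simplicialPoints_add_two [Fintype α] {ι : Type} [Fintype ι] [DecidableEq ι] {v : ι → α → ℕ}
    {e : α} (hv : ∀ i, v i e = 2) (hle : ∀ i x, v i x ≤ 2)
    (hinj : ∀ c d : ι → ℚ, (∀ x, ∑ i, c i * v i x = ∑ i, d i * v i x) → c = d)
    {T : Finset ι} {j : ι} (hj : j ∉ T) (k : ℕ) :
    (simplicialPoints v T (k + 2)).ncard =
      (simplicialPoints v (insert j T) (k + 2)).ncard + (simplicialPoints v T k).ncard := by
  have hfin : ∀ T k, (simplicialPoints v T k).Finite := fun T k =>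
    (finite_setOf_le k).subset fun L hL => hL.1
  have hshift : Function.Injective (fun L : α → ℕ => L + v j) := add_left_injective _
  rw [← Set.ncard_image_of_injective (simplicialPoints v T k) hshift,
    ← Set.ncard_union_eq _ (hfin _ _) ((hfin _ _).image _)]
  · congr 1
    ext L
    simp only [Set.mem_union, Set.mem_image]
    constructor
    · rintro ⟨hLk, c, hc, hcT, hL⟩
      by_cases hcj : c j ≤ 1
      · refine Or.inl ⟨hLk, c, hc, fun i hi => ?_, hL⟩
        obtain rfl | hi := Finset.mem_insert.1 hi
        exacts [hcj, hcT i hi]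
      · push Not at hcj
        have hge : ∀ x, v j x ≤ L x := fun x => by
          have h1 : c j * v j x ≤ ∑ i, c i * v i x :=
            Finset.single_le_sum (f := fun i => c i * (v i x : ℚ))
              (fun i _ => mul_nonneg (hc i).le (Nat.cast_nonneg _)) (Finset.mem_univ j)
          have h2 : (v j x : ℚ) ≤ c j * v j x := le_mul_of_one_le_left (Nat.cast_nonneg _) hcj.le
          exact_mod_cast (h2.trans h1).trans_eq (hL x).symm
        have hsum : ∀ x, ((L x - v j x : ℕ) : ℚ) =
            ∑ i, (Function.update c j (c j - 1)) i * v i x := fun x => by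
          rw [Nat.cast_sub (hge x), hL x, ← Finset.add_sum_erase _ _ (Finset.mem_univ j),
            ← Finset.add_sum_erase _ (fun i => Function.update c j (c j - 1) i * (v i x : ℚ))
              (Finset.mem_univ j)]
          have herase : ∀ i ∈ Finset.univ.erase j,
              Function.update c j (c j - 1) i * (v i x : ℚ) = c i * v i x := fun i hi => by
            rw [Function.update_of_ne (Finset.ne_of_mem_erase hi)]
          rw [Finset.sum_congr rfl herase, Function.update_self]
          ring
        have hpos : ∀ i, 0 < Function.update c j (c j - 1) i := fun i => by
          obtain rfl | hi := eq_or_ne i j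
          · simpa using hcj
          · simpa [Function.update_of_ne hi] using hc i
        refine Or.inr ⟨fun x => L x - v j x, ⟨fun x => ?_, _, hpos, fun i hi => ?_, hsum⟩, ?_⟩
        · have h1 : ((L x - v j x : ℕ) : ℚ) ≤ ((L e - v j e : ℕ) : ℚ) := by
            rw [hsum, hsum]
            refine Finset.sum_le_sum fun i _ => mul_le_mul_of_nonneg_left ?_ (hpos i).le
            rw [hv]
            exact_mod_cast hle i x
          have h2 := hLk e
          have h3 := hv j
          have h4 : L x - v j x ≤ L e - v j e := by exact_mod_cast h1
          change L x - v j x ≤ k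
          omega
        · rw [Function.update_of_ne (by rintro rfl; exact hj hi)]
          exact hcT i hi
        · ext x
          exact Nat.sub_add_cancel (hge x)
    · rintro (⟨hLk, c, hc, hcT, hL⟩ | ⟨L, ⟨hLk, c, hc, hcT, hL⟩, rfl⟩)
      · exact ⟨hLk, c, hc, fun i hi => hcT i (Finset.mem_insert_of_mem hi), hL⟩
      · refine ⟨fun x => add_le_add (hLk x) (hle j x), c + Pi.single j 1, fun i => ?_,
          fun i hi => ?_, fun x => ?_⟩
        · have : (0 : ι → ℚ) ≤ Pi.single j 1 := Pi.single_nonneg.2 zero_le_one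
          exact add_pos_of_pos_of_nonneg (hc i) (this i)
        · have : i ≠ j := by rintro rfl; exact hj hi
          simpa [this] using hcT i hi
        · simp [add_mul, Finset.sum_add_distrib, hL, Pi.single_apply]
  · rw [Set.disjoint_left]
    rintro _ ⟨-, d, -, hdT, hd⟩ ⟨L, ⟨-, c, hc, -, hL⟩, rfl⟩
    have : d = c + Pi.single j 1 := hinj _ _ fun x => by
      rw [← hd]
      simp [add_mul, Finset.sum_add_distrib, hL, Pi.single_apply]
    have h1 := hdT j (Finset.mem_insert_self _ _)
    have h2 := hc j
    rw [this] at h1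
    simp at h1
    linarith

lemma isQuasiPolyTwoFrom_ncard_simplicialPoints [Fintype α] {ι : Type} [Fintype ι] [DecidableEq ι]
    {v : ι → α → ℕ} {e : α} (hv : ∀ i, v i e = 2) (hle : ∀ i x, v i x ≤ 2)
    (hinj : ∀ c d : ι → ℚ, (∀ x, ∑ i, c i * v i x = ∑ i, d i * v i x) → c = d)
    (T : Finset ι) :
    IsQuasiPolyTwoFrom (fun k => (simplicialPoints v T k).ncard) (2 * #T) := by
  induction hn : #Tᶜ generalizing T with
  | zero =>
    obtain rfl : T = Finset.univ := by simpa using hn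
    refine ⟨fun _ => Polynomial.C
      ((simplicialPoints v Finset.univ (2 * #(Finset.univ : Finset ι))).ncard : ℚ),
      fun t ht => ?_⟩
    rw [Polynomial.eval_C]
    refine congrArg (fun S : Set (α → ℕ) => (S.ncard : ℚ)) ?_
    ext L
    have hbound : ∀ c : ι → ℚ, (∀ i, 0 < c i) → (∀ i ∈ Finset.univ, c i ≤ 1) →
        (∀ x, (L x : ℚ) = ∑ i, c i * v i x) → ∀ x, L x ≤ 2 * #(Finset.univ : Finset ι) := by
      intro c hc hc1 hL x
      have : (L x : ℚ) ≤ ∑ i : ι, 2 := by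
        rw [hL]
        refine Finset.sum_le_sum fun i hi => ?_
        have h1 : (v i x : ℚ) ≤ 2 := by exact_mod_cast hle i x
        have h2 := hc1 i hi
        have h3 := hc i
        nlinarith [Nat.cast_nonneg (α := ℚ) (v i x)]
      rw [Finset.sum_const, nsmul_eq_mul, mul_comm] at this
      exact_mod_cast this
    constructor
    · rintro ⟨-, c, hc, hc1, hL⟩
      exact ⟨hbound c hc hc1 hL, c, hc, hc1, hL⟩
    · rintro ⟨-, c, hc, hc1, hL⟩
      exact ⟨fun x => (hbound c hc hc1 hL x).trans ht, c, hc, hc1, hL⟩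
  | succ n ih =>
    obtain ⟨j, hj⟩ : Tᶜ.Nonempty := Finset.card_pos.1 (by omega)
    have hjT : j ∉ T := Finset.mem_compl.1 hj
    have := ih (insert j T) (by rw [Finset.compl_insert, Finset.card_erase_of_mem hj]; omega)
    rw [Finset.card_insert_of_notMem hjT, mul_add] at this
    exact this.of_add_two fun k => ncard_simplicialPoints_add_two hv hle hinj hjT k

/-! ### Pulling decomposition of a cone `M ∩ {y ≥ 0}` -/

/-- Lattice points with entries at most `k` of the form `∑ i, c i • v i + y`, where all `c i` are
positive and `y` is a nonnegative element of `M` with support `F`. -/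
def pulledPoints (M : Submodule ℚ (α → ℚ)) {n : ℕ} (v : Fin n → α → ℕ) (F : Finset α) (k : ℕ) :
    Set (α → ℕ) :=
  {L | (∀ x, L x ≤ k) ∧ ∃ (c : Fin n → ℚ) (y : α → ℚ), (∀ i, 0 < c i) ∧ y ∈ M ∧
    (∀ x ∈ F, 0 < y x) ∧ (∀ x ∉ F, y x = 0) ∧ ∀ x, (L x : ℚ) = ∑ i, c i * v i x + y x}

lemma finite_pulledPoints [Fintype α] (M : Submodule ℚ (α → ℚ)) {n : ℕ} (v : Fin n → α → ℕ) (F : Finset α)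
    (k : ℕ) : (pulledPoints M v F k).Finite :=
  (finite_setOf_le k).subset fun _ hL => hL.1

lemma nonneg_of_pos_of_eq_zero {F : Finset α} {y : α → ℚ} (h1 : ∀ x ∈ F, 0 < y x)
    (h2 : ∀ x ∉ F, y x = 0) (x : α) : 0 ≤ y x := by
  by_cases hx : x ∈ F
  exacts [(h1 x hx).le, (h2 x hx).ge]

lemma eq_of_support_eq {F G : Finset α} {y z : α → ℚ} (hyz : y = z)
    (hy : ∀ x ∈ F, 0 < y x) (hy' : ∀ x ∉ F, y x = 0) (hz : ∀ x ∈ G, 0 < z x)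
    (hz' : ∀ x ∉ G, z x = 0) : F = G := by
  subst hyz
  ext x
  constructor
  · intro h
    by_contra hG
    exact (hy x h).ne' (hz' x hG)
  · intro h
    by_contra hF
    exact (hz x h).ne' (hy' x hF)

/-- The vectors `v i` are linearly independent modulo the vectors supported in `F`. -/
def IndepModulo {n : ℕ} (v : Fin n → α → ℕ) (F : Finset α) : Prop :=
  ∀ (c : Fin n → ℚ) (y : α → ℚ), (∀ x ∉ F, y x = 0) →
    (∀ x, ∑ i, c i * v i x + y x = 0) → c = 0

lemma IndepModulo.cons {n : ℕ} {v : Fin n → α → ℕ} {F G : Finset α} (hv : IndepModulo v F)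
    {w : α → ℕ} (hw : ∀ x ∉ F, w x = 0) (hGF : G ⊆ F) (hwG : ∃ x ∉ G, w x ≠ 0) :
    IndepModulo (Fin.cons w v : Fin (n + 1) → α → ℕ) G := by
  intro c y hy h
  simp only [Fin.sum_univ_succ, Fin.cons_zero, Fin.cons_succ] at h
  have h1 : (fun i : Fin n => c i.succ) = 0 :=
    hv _ (fun x => c 0 * w x + y x) (fun x hx => by simp [hw x hx, hy x fun hx' => hx (hGF hx')])
      fun x => by rw [← h x]; ring
  have h2 : ∀ i : Fin n, c i.succ = 0 := fun i => congrFun h1 i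
  obtain ⟨x, hxG, hx⟩ := hwG
  have h3 := h x
  simp only [h2, zero_mul, Finset.sum_const_zero, add_zero, hy x hxG] at h3
  have h4 : c 0 = 0 := (mul_eq_zero.1 h3).resolve_right (by exact_mod_cast hx)
  ext i
  refine Fin.cases h4 h2 i

lemma isQuasiPolyTwoFrom_of_eq_biUnion {β ι : Type} {S : ℕ → Set β} {s : Finset ι}
    {R : ι → ℕ → Set β} (hS : ∀ k, S k = ⋃ i ∈ s, R i k) (hfin : ∀ i k, (R i k).Finite)
    (hdisj : ∀ k, ∀ i ∈ s, ∀ j ∈ s, ∀ L, L ∈ R i k → L ∈ R j k → i = j)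
    (hR : ∀ i ∈ s, IsQuasiPolyTwoFrom (fun k => (R i k).ncard) 0) :
    IsQuasiPolyTwoFrom (fun k => (S k).ncard) 0 := by
  convert IsQuasiPolyTwoFrom.sum hR using 2 with k
  rw [hS, ← finsum_mem_coe_finset]
  refine Set.Finite.ncard_biUnion s.finite_toSet (fun i _ => hfin i k) ?_
  intro i hi j hj hij
  exact Set.disjoint_left.2 fun L h1 h2 => hij (hdisj k i hi j hj L h1 h2)

lemma pulledPoints_eq_biUnion [Fintype α] [DecidableEq α] {M : Submodule ℚ (α → ℚ)} {n : ℕ}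
    {v : Fin n → α → ℕ} {F : Finset α} {w : α → ℕ} (hwM : (fun x => (w x : ℚ)) ∈ M)
    (hwF : ∀ x ∉ F, w x = 0) (hw : ∃ x, w x ≠ 0) (k : ℕ) :
    pulledPoints M v F k =
      ⋃ G ∈ F.powerset.filter (fun G => (∃ x ∉ G, w x ≠ 0) ∧ ∀ x ∈ F, x ∉ G → w x ≠ 0),
        pulledPoints M (Fin.cons w v : Fin (n + 1) → α → ℕ) G k := by
  ext L
  simp only [Set.mem_iUnion, Finset.mem_filter, Finset.mem_powerset]
  constructor
  · rintro ⟨hLk, c, y, hc, hyM, hyF, hyF', hL⟩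
    obtain ⟨x₀, hx₀, hmin⟩ := Finset.exists_min_image (Finset.univ.filter fun x => w x ≠ 0)
      (fun x => y x / w x) (by obtain ⟨x, hx⟩ := hw; exact ⟨x, by simpa using hx⟩)
    simp only [Finset.mem_filter, Finset.mem_univ, true_and] at hx₀ hmin
    have hwpos : ∀ x, w x ≠ 0 → (0 : ℚ) < w x := fun x hx => by
      exact_mod_cast Nat.pos_of_ne_zero hx
    have hx₀F : x₀ ∈ F := by
      by_contra h
      exact hx₀ (hwF _ h)
    let a : ℚ := y x₀ / w x₀
    have ha : 0 < a := div_pos (hyF x₀ hx₀F) (hwpos _ hx₀)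
    let z : α → ℚ := fun x => y x - a * w x
    have hz : ∀ x, 0 ≤ z x := fun x => by
      by_cases hx : w x = 0
      · simpa [z, hx] using nonneg_of_pos_of_eq_zero hyF hyF' x
      · have := (le_div_iff₀ (hwpos x hx)).1 (hmin x hx)
        simpa [z] using this
    have hz₀ : z x₀ = 0 := by
      simp only [z, a]
      rw [div_mul_cancel₀ _ (hwpos x₀ hx₀).ne', sub_self]
    refine ⟨Finset.univ.filter fun x => z x ≠ 0, ⟨fun x hx => ?_, ⟨x₀, by simpa using hz₀, hx₀⟩,
      fun x hxF hx hwx => ?_⟩, hLk, Fin.cons a c, z, ?_, ?_, ?_, ?_, ?_⟩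
    · by_contra hxF
      simp [z, hyF' x hxF, hwF x hxF] at hx
    · simp only [Finset.mem_filter, Finset.mem_univ, true_and, not_not, z, hwx] at hx
      have := hyF x hxF
      simp at hx
      exact this.ne' hx
    · exact fun i => Fin.cases (by simpa using ha) (by simpa using hc) i
    · exact M.sub_mem hyM (M.smul_mem a hwM)
    · intro x hx
      simp only [Finset.mem_filter, Finset.mem_univ, true_and] at hx
      exact (hz x).lt_of_ne' hx
    · intro x hx
      simpa using hx
    · intro x
      simp only [Fin.sum_univ_succ, Fin.cons_zero, Fin.cons_succ, hL, z]
      ring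
  · rintro ⟨G, ⟨hGF, -, hFG⟩, hLk, c, z, hc, hzM, hzG, hzG', hL⟩
    refine ⟨hLk, fun i => c i.succ, fun x => c 0 * w x + z x, fun i => hc _,
      M.add_mem (M.smul_mem (c 0) hwM) hzM, fun x hx => ?_, fun x hx => ?_, fun x => ?_⟩
    · by_cases hxG : x ∈ G
      · exact add_pos_of_nonneg_of_pos (mul_nonneg (hc 0).le (Nat.cast_nonneg _)) (hzG x hxG)
      · have : (0 : ℚ) < w x := by exact_mod_cast Nat.pos_of_ne_zero (hFG x hx hxG)
        simpa [hzG' x hxG] using mul_pos (hc 0) this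
    · simp [hwF x hx, hzG' x fun h => hx (hGF h)]
    · rw [hL]
      simp only [Fin.sum_univ_succ, Fin.cons_zero, Fin.cons_succ]
      ring

lemma IndepModulo.eq_of_mem_pulledPoints_cons {M : Submodule ℚ (α → ℚ)} {n : ℕ}
    {v : Fin n → α → ℕ} {F G H : Finset α} (hv : IndepModulo v F) {w : α → ℕ}
    (hwF : ∀ x ∉ F, w x = 0) (hGF : G ⊆ F) (hHF : H ⊆ F) (hwG : ∃ x ∉ G, w x ≠ 0)
    (hwH : ∃ x ∉ H, w x ≠ 0) {k : ℕ} {L : α → ℕ}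
    (hLG : L ∈ pulledPoints M (Fin.cons w v : Fin (n + 1) → α → ℕ) G k)
    (hLH : L ∈ pulledPoints M (Fin.cons w v : Fin (n + 1) → α → ℕ) H k) : G = H := by
  obtain ⟨-, c, y, -, -, hyG, hyG', hL⟩ := hLG
  obtain ⟨-, d, z, -, -, hzH, hzH', hL'⟩ := hLH
  simp only [Fin.sum_univ_succ, Fin.cons_zero, Fin.cons_succ] at hL hL'
  have h1 : (fun i : Fin n => c i.succ - d i.succ) = 0 := by
    refine hv _ (fun x => (c 0 * w x + y x) - (d 0 * w x + z x)) (fun x hx => ?_) fun x => ?_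
    · simp [hwF x hx, hyG' x fun h => hx (hGF h), hzH' x fun h => hx (hHF h)]
    · simp only [sub_mul, Finset.sum_sub_distrib]
      linarith [hL x, hL' x]
  have h2 : ∀ i : Fin n, c i.succ = d i.succ := fun i => sub_eq_zero.1 (congrFun h1 i)
  have h3 : ∀ x, c 0 * w x + y x = d 0 * w x + z x := fun x => by
    have h4 := hL x
    have h5 := hL' x
    simp only [h2] at h4
    linarith
  have hy := nonneg_of_pos_of_eq_zero hyG hyG'
  have hz := nonneg_of_pos_of_eq_zero hzH hzH'
  have h4 : d 0 ≤ c 0 := by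
    obtain ⟨x, hx, hwx⟩ := hwG
    have hwpos : (0 : ℚ) < w x := by exact_mod_cast Nat.pos_of_ne_zero hwx
    have := h3 x
    rw [hyG' x hx] at this
    exact le_of_mul_le_mul_right (by linarith [hz x]) hwpos
  have h5 : c 0 ≤ d 0 := by
    obtain ⟨x, hx, hwx⟩ := hwH
    have hwpos : (0 : ℚ) < w x := by exact_mod_cast Nat.pos_of_ne_zero hwx
    have := h3 x
    rw [hzH' x hx] at this
    exact le_of_mul_le_mul_right (by linarith [hy x]) hwpos
  have h6 : y = z := by
    ext x
    have := h3 x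
    rw [le_antisymm h5 h4] at this
    linarith
  exact eq_of_support_eq h6 hyG hyG' hzH hzH'

lemma isQuasiPolyTwoFrom_ncard_pulledPoints [Fintype α] [DecidableEq α] {M : Submodule ℚ (α → ℚ)} {e : α}
    (hM : ∀ y ∈ M, (∀ x, 0 ≤ y x) → y ≠ 0 → ∃ w : α → ℕ, (fun x => (w x : ℚ)) ∈ M ∧ w e = 2 ∧
      (∀ x, w x ≤ 2) ∧ ∀ x, w x ≠ 0 → y x ≠ 0)
    (F : Finset α) {n : ℕ} (v : Fin n → α → ℕ) (hv : ∀ i, v i e = 2) (hle : ∀ i x, v i x ≤ 2)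
    (hind : IndepModulo v F) :
    IsQuasiPolyTwoFrom (fun k => (pulledPoints M v F k).ncard) 0 := by
  induction F using Finset.strongInduction generalizing n v with
  | H F ih =>
    obtain rfl | hF := F.eq_empty_or_nonempty
    · have hinj : ∀ c d : Fin n → ℚ, (∀ x, ∑ i, c i * v i x = ∑ i, d i * v i x) → c = d :=
        fun c d h => sub_eq_zero.1 <| hind (c - d) 0 (by simp) fun x => by
          simp [sub_mul, Finset.sum_sub_distrib, h x]
      have hsimp := isQuasiPolyTwoFrom_ncard_simplicialPoints hv hle hinj ∅
      rw [Finset.card_empty, mul_zero] at hsimp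
      convert hsimp using 3 with k
      ext L
      constructor
      · rintro ⟨hLk, c, y, hc, -, -, hy, hL⟩
        exact ⟨hLk, c, hc, by simp, fun x => by simpa [hy x] using hL x⟩
      · rintro ⟨hLk, c, hc, -, hL⟩
        exact ⟨hLk, c, 0, hc, M.zero_mem, by simp, by simp, by simpa using hL⟩
    · by_cases hy : ∃ y ∈ M, (∀ x ∈ F, 0 < y x) ∧ ∀ x ∉ F, y x = 0
      · obtain ⟨y, hyM, hyF, hyF'⟩ := hy
        obtain ⟨x, hx⟩ := hF
        obtain ⟨w, hwM, hwe, hw2, hwy⟩ := hM y hyM (nonneg_of_pos_of_eq_zero hyF hyF')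
          (by rintro rfl; exact lt_irrefl _ (hyF x hx))
        have hwF : ∀ x ∉ F, w x = 0 := fun x hx => by
          by_contra h
          exact hwy x h (hyF' x hx)
        refine isQuasiPolyTwoFrom_of_eq_biUnion
          (pulledPoints_eq_biUnion hwM hwF ⟨e, by simp [hwe]⟩)
          (fun G k => finite_pulledPoints _ _ _ _) ?_ ?_
        · intro k G hG H hH L hLG hLH
          simp only [Finset.mem_filter, Finset.mem_powerset] at hG hH
          exact hind.eq_of_mem_pulledPoints_cons hwF hG.1 hH.1 hG.2.1 hH.2.1 hLG hLH
        · intro G hG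
          simp only [Finset.mem_filter, Finset.mem_powerset] at hG
          obtain ⟨hGF, ⟨x, hxG, hwx⟩, -⟩ := hG
          refine ih G ⟨hGF, fun h => ?_⟩ _ (Fin.cases hwe hv) (Fin.cases hw2 hle)
            (hind.cons hwF hGF ⟨x, hxG, hwx⟩)
          exact hwx (hwF x fun hx => hxG (h hx))
      · have : ∀ k, pulledPoints M v F k = ∅ := fun k => by
          rw [Set.eq_empty_iff_forall_notMem]
          rintro L ⟨-, c, y, -, hyM, hyF, hyF', -⟩
          exact hy ⟨y, hyM, hyF, hyF'⟩
        exact ⟨0, fun t _ => by simp [this]⟩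

theorem isQuasiPolyTwoFrom_ncard_nat_points [Fintype α] {M : Submodule ℚ (α → ℚ)} {e : α}
    (hM : ∀ y ∈ M, (∀ x, 0 ≤ y x) → y ≠ 0 → ∃ w : α → ℕ, (fun x => (w x : ℚ)) ∈ M ∧ w e = 2 ∧
      (∀ x, w x ≤ 2) ∧ ∀ x, w x ≠ 0 → y x ≠ 0) :
    IsQuasiPolyTwoFrom
      (fun k => {L : α → ℕ | (fun x => (L x : ℚ)) ∈ M ∧ ∀ x, L x ≤ k}.ncard) 0 := by
  classical
  refine isQuasiPolyTwoFrom_of_eq_biUnion (s := (Finset.univ : Finset (Finset α)))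
    (R := fun F => pulledPoints M (Fin.elim0 : Fin 0 → α → ℕ) F) (fun k => ?_)
    (fun F k => finite_pulledPoints _ _ _ _) ?_ fun F _ =>
      isQuasiPolyTwoFrom_ncard_pulledPoints hM F _ (fun i => i.elim0) (fun i => i.elim0)
        fun c _ _ _ => Subsingleton.elim _ _
  · ext L
    simp only [Set.mem_iUnion, Finset.mem_univ, exists_true_left]
    constructor
    · rintro ⟨hLM, hLk⟩
      refine ⟨Finset.univ.filter fun x => L x ≠ 0, hLk, 0, _, fun i => i.elim0, hLM,
        fun x hx => ?_, fun x hx => ?_, fun x => by simp⟩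
      · simp only [Finset.mem_filter, Finset.mem_univ, true_and] at hx
        exact_mod_cast Nat.pos_of_ne_zero hx
      · simpa using hx
    · rintro ⟨F, hLk, c, y, -, hyM, -, -, hL⟩
      refine ⟨?_, hLk⟩
      convert hyM using 1
      ext x
      simpa using hL x
  · rintro k F - G - L ⟨-, c, y, -, -, hyF, hyF', hL⟩ ⟨-, d, z, -, -, hzG, hzG', hL'⟩
    refine eq_of_support_eq ?_ hyF hyF' hzG hzG'
    ext x
    have h1 := hL x
    have h2 := hL' x
    simp only [Finset.univ_eq_empty, Finset.sum_empty, zero_add] at h1 h2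
    rw [← h1, h2]

end Cone

/-! ### Magic labelings of index two -/

section Graph

variable {V : Type} [DecidableEq V]

/-- The space of rational edge labelings with the same label sum at every vertex. -/
def magicSubmodule (E : Finset (Sym2 V)) : Submodule ℚ (E → ℚ) where
  carrier := {y | ∀ v w : V, (∑ e ∈ E.attach, if v ∈ e.1 then y e else 0) =
    ∑ e ∈ E.attach, if w ∈ e.1 then y e else 0}
  zero_mem' := by simp
  add_mem' {y z} hy hz v w := by
    simp only [← Finset.sum_filter, Pi.add_apply, Finset.sum_add_distrib] at *
    rw [hy v w, hz v w]
  smul_mem' c y hy v w := by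
    simp only [← Finset.sum_filter, Pi.smul_apply, ← Finset.smul_sum] at *
    rw [hy v w]

lemma cast_vsum (E : Finset (Sym2 V)) (L : E → ℕ) (v : V) :
    (vsum E L v : ℚ) = ∑ e ∈ E.attach, if v ∈ e.1 then (L e : ℚ) else 0 := by
  simp [vsum]

lemma cast_mem_magicSubmodule_iff (E : Finset (Sym2 V)) (L : E → ℕ) :
    (fun x => (L x : ℚ)) ∈ magicSubmodule E ↔ IsMagic E L := by
  refine forall₂_congr fun v w => ?_
  rw [← cast_vsum, ← cast_vsum, Nat.cast_inj]

lemma exists_vsum_eq_two_of_perm [Fintype V] {E : Finset (Sym2 V)} (σ : Equiv.Perm V)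
    (hσ : ∀ u, s(u, σ u) ∈ E) :
    ∃ L : E → ℕ, (∀ v, vsum E L v = 2) ∧ ∀ x, L x ≠ 0 → ∃ u, s(u, σ u) = x.1 := by
  refine ⟨fun x => ∑ u, if s(u, σ u) = x.1 then (if σ u = u then 2 else 1) else 0, fun v => ?_,
    fun x hx => ?_⟩
  · have h1 : ∀ u, (∑ x ∈ E.attach, if v ∈ x.1 then
        (if s(u, σ u) = x.1 then (if σ u = u then 2 else 1) else 0) else 0) =
        (if u = v then 1 else 0) + if u = σ.symm v then 1 else 0 := by
      intro u
      rw [Finset.sum_eq_single (⟨s(u, σ u), hσ u⟩ : E)]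
      · simp only [Sym2.mem_iff, if_true, Equiv.eq_symm_apply]
        grind
      · intro x _ hx
        rw [if_neg (c := s(u, σ u) = x.1) fun h => hx (Subtype.ext h.symm), ite_self]
      · simp
    have h2 : vsum E (fun x => ∑ u, if s(u, σ u) = x.1 then (if σ u = u then 2 else 1) else 0) v =
        ∑ u, ∑ x ∈ E.attach, if v ∈ x.1 then
          (if s(u, σ u) = x.1 then (if σ u = u then 2 else 1) else 0) else 0 := by
      rw [Finset.sum_comm, vsum]
      refine Finset.sum_congr rfl fun x _ => ?_
      split_ifs <;> simp
    rw [h2, Finset.sum_congr rfl fun u _ => h1 u, Finset.sum_add_distrib]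
    simp
  · by_contra! h
    exact hx (Finset.sum_eq_zero fun u _ => if_neg (h u))

lemma sum_extend_eq [Fintype V] (E : Finset (Sym2 V)) (y : E → ℚ) (u : V) :
    (∑ v, if h : s(u, v) ∈ E then y ⟨s(u, v), h⟩ else 0) =
      ∑ x ∈ E.attach, if u ∈ x.1 then y x else 0 := by
  have h1 : ∀ x : E, (if u ∈ x.1 then y x else 0) = ∑ v, if x.1 = s(u, v) then y x else 0 := by
    intro x
    split_ifs with hu
    · obtain ⟨v, hv⟩ := hu
      have hvw : ∀ w, s(u, v) = s(u, w) ↔ v = w := fun w => Sym2.congr_right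
      simp only [hv, hvw, Finset.sum_ite_eq, Finset.mem_univ, if_true]
    · refine (Finset.sum_eq_zero fun v _ => if_neg fun h => hu ?_).symm
      rw [h]
      exact Sym2.mem_mk_left _ _
  rw [Finset.sum_congr rfl fun x _ => h1 x, Finset.sum_comm]
  refine Finset.sum_congr rfl fun v _ => ?_
  split_ifs with h
  · rw [Finset.sum_eq_single (⟨s(u, v), h⟩ : E)]
    · simp
    · intro x _ hx
      exact if_neg fun h' => hx (Subtype.ext h')
    · simp
  · refine (Finset.sum_eq_zero fun x _ => if_neg fun h' => h ?_).symm
    rw [← h']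
    exact x.2

lemma exists_vsum_eq_two_of_mem_magicSubmodule [Fintype V] {E : Finset (Sym2 V)} {y : E → ℚ}
    (hy : y ∈ magicSubmodule E) (hy0 : ∀ x, 0 ≤ y x) (hne : y ≠ 0) :
    ∃ L : E → ℕ, (∀ v, vsum E L v = 2) ∧ ∀ x, L x ≠ 0 → y x ≠ 0 := by
  obtain ⟨x₀, hx₀⟩ := Function.ne_iff.1 hne
  have hpos : 0 < y x₀ := (hy0 x₀).lt_of_ne' hx₀
  obtain ⟨v₀, hv₀⟩ : ∃ v, v ∈ x₀.1 := ⟨_, Sym2.out_fst_mem x₀.1⟩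
  set r : ℚ := ∑ x ∈ E.attach, if v₀ ∈ x.1 then y x else 0 with hr
  have hrpos : 0 < r := by
    refine Finset.sum_pos' (fun x _ => ?_) ⟨x₀, Finset.mem_attach _ _, by simpa [hv₀] using hpos⟩
    split_ifs
    exacts [hy0 x, le_rfl]
  let A : Matrix V V ℚ := fun u v => r⁻¹ * if h : s(u, v) ∈ E then y ⟨s(u, v), h⟩ else 0
  have hsymm : ∀ u v, A u v = A v u := fun u v => by
    simp only [A, Sym2.eq_swap (a := u) (b := v)]
  have hrow : ∀ u, ∑ v, A u v = 1 := fun u => by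
    simp only [A]
    rw [← Finset.mul_sum, sum_extend_eq, hy u v₀, ← hr, inv_mul_cancel₀ hrpos.ne']
  have hA : A ∈ doublyStochastic ℚ V := by
    rw [mem_doublyStochastic_iff_sum]
    refine ⟨fun u v => mul_nonneg (inv_nonneg.2 hrpos.le) ?_, hrow, fun v => ?_⟩
    · split_ifs
      exacts [hy0 _, le_rfl]
    · simpa only [hsymm _ v] using hrow v
  obtain ⟨c, hc, hc1, hcA⟩ := exists_eq_sum_perm_of_mem_doublyStochastic hA
  obtain ⟨σ, hσ⟩ : ∃ σ, 0 < c σ := by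
    by_contra! h
    have := Finset.sum_nonpos fun σ (_ : σ ∈ Finset.univ) => h σ
    linarith
  have hAσ : ∀ u, 0 < A u (σ u) := fun u => by
    rw [← hcA, Matrix.sum_apply]
    refine Finset.sum_pos' (fun τ _ => ?_) ⟨σ, Finset.mem_univ _, ?_⟩
    · simp only [Matrix.smul_apply, PEquiv.toMatrix_apply, smul_eq_mul]
      refine mul_nonneg (hc τ) ?_
      split_ifs
      exacts [zero_le_one, le_rfl]
    · simpa [PEquiv.toMatrix_apply, Equiv.toPEquiv_apply] using hσ
  have hσE : ∀ u, ∃ h : s(u, σ u) ∈ E, y ⟨s(u, σ u), h⟩ ≠ 0 := fun u => by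
    have := hAσ u
    by_cases h : s(u, σ u) ∈ E
    · refine ⟨h, fun h0 => ?_⟩
      simp [A, h, h0] at this
    · simp [A, h] at this
  obtain ⟨L, hL, hLσ⟩ := exists_vsum_eq_two_of_perm σ fun u => (hσE u).1
  refine ⟨L, hL, fun x hx => ?_⟩
  obtain ⟨u, hu⟩ := hLσ x hx
  obtain ⟨h, hyu⟩ := hσE u
  rwa [show (⟨s(u, σ u), h⟩ : E) = x from Subtype.ext hu] at hyu

lemma label_le_vsum {E : Finset (Sym2 V)} (L : E → ℕ) {x : E} {v : V} (hv : v ∈ x.1) :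
    L x ≤ vsum E L v := by
  have := Finset.single_le_sum (f := fun x : E => if v ∈ x.1 then L x else 0)
    (fun _ _ => Nat.zero_le _) (Finset.mem_attach E x)
  rw [if_pos hv] at this
  exact this

end Graph

/-- If some edge `e` attains the maximum label in every magic labeling of index `2`,
then `M_G` is a quasipolynomial admitting `2` as a quasiperiod. -/
theorem magicCount_quasiperiod_two {V : Type} [Fintype V] [DecidableEq V]
    (E : Finset (Sym2 V)) (e : Sym2 V) (he : e ∈ E)
    (hmax : ∀ L : ↥E → ℕ, (∀ v : V, vsum E L v = 2) → L ⟨e, he⟩ = maxLabel E L) :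
    IsQuasiPoly (fun k => (magicCount E k : ℚ)) 2 := by
  have hpos : ∀ y ∈ magicSubmodule E, (∀ x, 0 ≤ y x) → y ≠ 0 → ∃ w : E → ℕ,
      (fun x => (w x : ℚ)) ∈ magicSubmodule E ∧ w ⟨e, he⟩ = 2 ∧ (∀ x, w x ≤ 2) ∧
        ∀ x, w x ≠ 0 → y x ≠ 0 := by
    intro y hy hy0 hne
    obtain ⟨L, hL, hLy⟩ := exists_vsum_eq_two_of_mem_magicSubmodule hy hy0 hne
    have hle : ∀ x, L x ≤ L ⟨e, he⟩ := fun x => by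
      rw [hmax L hL]
      exact Finset.le_sup (Finset.mem_attach E x)
    obtain ⟨v, hv⟩ : ∃ v, v ∈ e := ⟨_, Sym2.out_fst_mem e⟩
    have hLe2 : L ⟨e, he⟩ ≤ 2 := hL v ▸ label_le_vsum L hv
    have hLe0 : L ⟨e, he⟩ ≠ 0 := fun h => by
      have h0 : ∀ x, L x = 0 := fun x => Nat.le_zero.1 (h ▸ hle x)
      have := hL v
      simp [vsum, h0] at this
    have hLM : (fun x => (L x : ℚ)) ∈ magicSubmodule E :=
      (cast_mem_magicSubmodule_iff E L).2 fun u w => by rw [hL, hL]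
    obtain h1 | h2 : L ⟨e, he⟩ = 1 ∨ L ⟨e, he⟩ = 2 := by omega
    · refine ⟨fun x => 2 * L x, ?_, by simp [h1], fun x => ?_, fun x hx => hLy x ?_⟩
      · convert (magicSubmodule E).smul_mem 2 hLM using 1
        ext x
        simp
      · have := hle x
        change 2 * L x ≤ 2
        omega
      · simpa using hx
    · exact ⟨L, hLM, h2, fun x => h2 ▸ hle x, hLy⟩
  obtain ⟨φ, hφ⟩ := isQuasiPolyTwoFrom_ncard_nat_points hpos
  refine ⟨two_pos, φ, fun t => ?_⟩
  rw [← hφ t (Nat.zero_le t)]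
  simp only [magicCount, cast_mem_magicSubmodule_iff]
end

section
/- Let G be a bipartite graph and suppose there is an edge e of G such that L(e) = max(L) for every magic labeling L of G of index 2. Then M_G is a polynomial; that is, there exists a polynomial p ∈ ℚ[x] such that M_G(k) = p(k) for all k ∈ ℕ. -/
open Finset

/-- The partial sums of a polynomial over `1, …, n` form a polynomial in `n`. -/
theorem Polynomial.exists_eval_eq_sum_range (q : Polynomial ℚ) :
    ∃ p : Polynomial ℚ, ∀ n : ℕ, p.eval (n : ℚ) = ∑ i ∈ range n, q.eval ((i + 1 : ℕ) : ℚ) := by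
  suffices h : ∀ q : Polynomial ℚ,
      ∃ p : Polynomial ℚ, ∀ n : ℕ, p.eval (n : ℚ) = ∑ i ∈ range n, q.eval (i : ℚ) by
    obtain ⟨p, hp⟩ := h (q.comp (Polynomial.X + 1))
    exact ⟨p, fun n => by simp [hp]⟩
  intro q
  induction q using Polynomial.induction_on' with
  | add q₁ q₂ h₁ h₂ =>
    obtain ⟨p₁, h₁⟩ := h₁
    obtain ⟨p₂, h₂⟩ := h₂
    exact ⟨p₁ + p₂, fun n => by simp [h₁, h₂, sum_add_distrib]⟩
  | monomial d c =>
    refine ⟨Polynomial.C c * ∑ i ∈ range (d + 1),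
      Polynomial.C (_root_.bernoulli i * ((d + 1).choose i : ℚ) / (d + 1 : ℚ)) *
        Polynomial.X ^ (d + 1 - i), fun n => ?_⟩
    simp only [Polynomial.eval_monomial, ← mul_sum, sum_range_pow, Polynomial.eval_mul,
      Polynomial.eval_C, Polynomial.eval_finsetSum, Polynomial.eval_pow, Polynomial.eval_X]
    congr 1
    exact sum_congr rfl fun i _ => by ring

/-- A regular bipartite multigraph of positive degree, with edge multiplicities `L`, contains a
perfect matching. -/
theorem exists_matching_le {ι α β : Type*} [Fintype ι] [DecidableEq ι] [Fintype α] [DecidableEq α]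
    [Fintype β] [DecidableEq β] (a : ι → α) (b : ι → β) (L : ι → ℕ) {r : ℕ} (hr : 0 < r)
    (ha : ∀ x, (∑ i, if a i = x then L i else 0) = r)
    (hb : ∀ y, (∑ i, if b i = y then L i else 0) = r) :
    ∃ m : ι → ℕ, m ≤ L ∧ (∀ x, (∑ i, if a i = x then m i else 0) = 1) ∧
      ∀ y, (∑ i, if b i = y then m i else 0) = 1 := by
  have hA : ∀ A : Finset α, (∑ i, if a i ∈ A then L i else 0) = #A * r := by
    intro A
    rw [← smul_eq_mul, ← sum_const, ← sum_congr rfl fun x _ => ha x, sum_comm]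
    simp
  have hB : ∀ B : Finset β, (∑ i, if b i ∈ B then L i else 0) = #B * r := by
    intro B
    rw [← smul_eq_mul, ← sum_const, ← sum_congr rfl fun x _ => hb x, sum_comm]
    simp
  let t : α → Finset β := fun x => ({i | a i = x ∧ L i ≠ 0} : Finset ι).image b
  have hall : ∀ A : Finset α, #A ≤ #(A.biUnion t) := by
    intro A
    refine Nat.le_of_mul_le_mul_right ?_ hr
    rw [← hA, ← hB]
    refine sum_le_sum fun i _ => ?_
    by_cases hi : a i ∈ A
    · by_cases hL : L i = 0
      · simp [hL]
      · have : b i ∈ A.biUnion t :=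
          mem_biUnion.2 ⟨a i, hi, mem_image_of_mem _ (by simpa using hL)⟩
        simp [hi, this]
    · simp [hi]
  obtain ⟨f, hf, hft⟩ := (all_card_le_biUnion_card_iff_exists_injective t).1 hall
  have hcard : Fintype.card α = Fintype.card β := by
    have h₁ := hA univ
    have h₂ := hB univ
    simp only [mem_univ, if_true, card_univ] at h₁ h₂
    exact Nat.eq_of_mul_eq_mul_right hr (h₁.symm.trans h₂)
  have hbij : Function.Bijective f := (Fintype.bijective_iff_injective_and_card f).2 ⟨hf, hcard⟩
  have hg : ∀ x, ∃ i, a i = x ∧ L i ≠ 0 ∧ b i = f x := by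
    intro x
    simpa [t, and_assoc] using hft x
  choose g hga hgL hgb using hg
  refine ⟨fun i => if g (a i) = i then 1 else 0, fun i => ?_, fun x => ?_, fun y => ?_⟩
  · dsimp only
    split_ifs with h
    · rw [← h]
      exact Nat.one_le_iff_ne_zero.2 (hgL _)
    · exact Nat.zero_le _
  · rw [Fintype.sum_eq_single (g x)]
    · simp [hga]
    · intro i hi
      rw [ite_eq_right_iff, ite_eq_right_iff]
      rintro rfl h
      exact absurd h.symm hi
  · obtain ⟨x, rfl⟩ := hbij.2 y
    rw [Fintype.sum_eq_single (g x)]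
    · simp [hga, hgb]
    · intro i hi
      rw [ite_eq_right_iff, ite_eq_right_iff]
      intro h₁ h₂
      rw [← h₂, hgb] at h₁
      exact absurd (h₂.symm.trans (congrArg g (hf h₁))) hi

section Labelings

variable {V : Type} [DecidableEq V] {E : Finset (Sym2 V)}

theorem vsum_add (L m : E → ℕ) (v : V) : vsum E (L + m) v = vsum E L v + vsum E m v := by
  simp only [vsum, ← sum_add_distrib]
  exact sum_congr rfl fun e _ => by split_ifs <;> simp

theorem le_vsum (L : E → ℕ) {e : E} {v : V} (hv : v ∈ e.1) : L e ≤ vsum E L v := by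
  have := single_le_sum (f := fun e : E => if v ∈ e.1 then L e else 0)
    (fun _ _ => Nat.zero_le _) (mem_attach E e)
  simpa [vsum, hv] using this

theorem le_of_vsum_eq {L : E → ℕ} {r : ℕ} (hL : ∀ v, vsum E L v = r) (e : E) : L e ≤ r := by
  rw [← hL (Quot.out e.1).1]
  exact le_vsum L (Sym2.out_fst_mem e.1)

/-- In a bipartite graph, every labeling of positive index dominates one of index `1`. -/
theorem IsBipartite.exists_le_vsum_eq_one [Fintype V] (hE : IsBipartite E) {L : E → ℕ} {r : ℕ}
    (hr : 0 < r) (hL : ∀ v, vsum E L v = r) :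
    ∃ m : E → ℕ, m ≤ L ∧ ∀ v, vsum E m v = 1 := by
  classical
  obtain ⟨S, hS⟩ := hE
  have hS' : ∀ e : E, ∃ (u : {v // v ∈ S}) (w : {v // v ∉ S}), e.1 = s(u.1, w.1) := by
    intro e
    obtain ⟨u, w, h, hu, hw⟩ := hS e.1 e.2
    exact ⟨⟨u, hu⟩, ⟨w, hw⟩, h⟩
  choose a b hab using hS'
  have hva : ∀ (L : E → ℕ) (x : {v // v ∈ S}),
      vsum E L x.1 = ∑ i, if a i = x then L i else 0 := by
    intro L x
    refine sum_congr rfl fun e _ => if_congr ?_ rfl rfl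
    rw [hab, Sym2.mem_iff, Subtype.ext_iff]
    have : x.1 ≠ (b e).1 := fun h => (b e).2 (h ▸ x.2)
    simp [this, eq_comm]
  have hvb : ∀ (L : E → ℕ) (x : {v // v ∉ S}),
      vsum E L x.1 = ∑ i, if b i = x then L i else 0 := by
    intro L x
    refine sum_congr rfl fun e _ => if_congr ?_ rfl rfl
    rw [hab, Sym2.mem_iff, Subtype.ext_iff]
    have : x.1 ≠ (a e).1 := fun h => x.2 (h ▸ (a e).2)
    simp [this, eq_comm]
  obtain ⟨m, hm, h₁, h₂⟩ := exists_matching_le a b L hr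
    (fun x => (hva L x).symm.trans (hL _)) (fun y => (hvb L y).symm.trans (hL _))
  refine ⟨m, hm, fun v => ?_⟩
  by_cases hv : v ∈ S
  · exact (hva m ⟨v, hv⟩).trans (h₁ _)
  · exact (hvb m ⟨v, hv⟩).trans (h₂ _)

variable [Fintype V]

/-- The labelings of index `r` vanishing on `Z`. -/
def labelingsOfIndex (Z : Finset E) (r : ℕ) : Finset (E → ℕ) :=
  {L ∈ Fintype.piFinset fun _ : E => range (r + 1) | (∀ v, vsum E L v = r) ∧ ∀ z ∈ Z, L z = 0}

theorem mem_labelingsOfIndex {Z : Finset E} {r : ℕ} {L : E → ℕ} :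
    L ∈ labelingsOfIndex Z r ↔ (∀ v, vsum E L v = r) ∧ ∀ z ∈ Z, L z = 0 := by
  simp only [labelingsOfIndex, mem_filter, Fintype.mem_piFinset, mem_range, and_iff_right_iff_imp]
  exact fun h e => Nat.lt_succ_of_le (le_of_vsum_eq h.1 e)

/-- Subtracting a fixed labeling `m` of index `1` from the labelings which are positive on the
support of `m`. -/
theorem card_labelingsOfIndex_succ {Z : Finset E} {m : E → ℕ} (hm : m ∈ labelingsOfIndex Z 1)
    (r : ℕ) :
    #(labelingsOfIndex Z (r + 1)) = #(labelingsOfIndex Z r) +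
      #(({e | m e ≠ 0} : Finset E).biUnion fun e => labelingsOfIndex (insert e Z) (r + 1)) := by
  classical
  rw [mem_labelingsOfIndex] at hm
  rw [← card_image_of_injective (labelingsOfIndex Z r) (add_left_injective m),
    ← card_union_of_disjoint]
  · congr 1
    ext L
    simp only [mem_union, mem_image, mem_biUnion, mem_filter, mem_univ, true_and,
      mem_labelingsOfIndex, forall_mem_insert]
    constructor
    · rintro ⟨h₁, h₂⟩
      by_cases h : ∃ e, m e ≠ 0 ∧ L e = 0
      · obtain ⟨e, he, h⟩ := h
        exact Or.inr ⟨e, he, h₁, h, h₂⟩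
      · push Not at h
        have hle : m ≤ L := by
          intro e
          by_cases he : m e = 0
          · simp [he]
          · exact (le_of_vsum_eq hm.1 e).trans (Nat.one_le_iff_ne_zero.2 (h e he))
        refine Or.inl ⟨L - m, ⟨fun v => ?_, fun z hz => ?_⟩, tsub_add_cancel_of_le hle⟩
        · have := vsum_add (L - m) m v
          rw [tsub_add_cancel_of_le hle, h₁, hm.1] at this
          omega
        · simp [h₂ z hz]
    · rintro (⟨L, ⟨h₁, h₂⟩, rfl⟩ | ⟨e, -, h₁, -, h₂⟩)
      · exact ⟨fun v => by rw [vsum_add, h₁, hm.1],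
          fun z hz => by simp [h₂ z hz, hm.2 z hz]⟩
      · exact ⟨h₁, h₂⟩
  · rw [disjoint_left]
    simp only [mem_image, mem_biUnion, mem_filter, mem_univ, true_and, mem_labelingsOfIndex,
      forall_mem_insert, not_exists]
    rintro _ ⟨L, -, rfl⟩ e ⟨he, -, h, -⟩
    simp_all

/-- In a bipartite graph, the number of labelings of index `r ≥ 1` is a polynomial in `r`. -/
theorem IsBipartite.exists_polynomial_card_labelingsOfIndex (hE : IsBipartite E) (Z : Finset E) :
    ∃ p : Polynomial ℚ, ∀ r : ℕ, (#(labelingsOfIndex Z (r + 1)) : ℚ) =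
      p.eval ((r + 1 : ℕ) : ℚ) := by
  classical
  induction hn : #(univ \ Z) using Nat.strong_induction_on generalizing Z with
  | _ n ih =>
  by_cases hZ : (labelingsOfIndex Z 1).Nonempty
  · obtain ⟨m, hm⟩ := hZ
    have hpos : ∀ T : Finset E, T.Nonempty → T ⊆ ({e | m e ≠ 0} : Finset E) →
        ∃ p : Polynomial ℚ, ∀ r : ℕ, (#(labelingsOfIndex (T ∪ Z) (r + 1)) : ℚ) =
          p.eval ((r + 1 : ℕ) : ℚ) := by
      rintro T ⟨e, he⟩ hT
      refine ih _ ?_ (T ∪ Z) rfl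
      rw [← hn]
      refine card_lt_card (Finset.ssubset_iff_subset_ne.2
        ⟨sdiff_subset_sdiff subset_rfl subset_union_right, fun h => ?_⟩)
      have : e ∈ univ \ (T ∪ Z) := by
        rw [h, mem_sdiff]
        exact ⟨mem_univ _, fun hez =>
          (mem_filter.1 (hT he)).2 ((mem_labelingsOfIndex.1 hm).2 e hez)⟩
      simp [he] at this
    choose! P hP using hpos
    obtain ⟨Q, hQ⟩ := Polynomial.exists_eval_eq_sum_range
      (∑ t : ({e | m e ≠ 0} : Finset E).powerset.filter (·.Nonempty),
        (-1 : Polynomial ℚ) ^ (#t.1 + 1) * P t.1)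
    refine ⟨Polynomial.C (#(labelingsOfIndex Z 0) : ℚ) + Q, fun r => ?_⟩
    suffices h : ∀ r : ℕ, (#(labelingsOfIndex Z r) : ℚ) =
        (Polynomial.C (#(labelingsOfIndex Z 0) : ℚ) + Q).eval (r : ℚ) from h (r + 1)
    intro r
    rw [Polynomial.eval_add, Polynomial.eval_C, hQ]
    clear hQ
    induction r with
    | zero => simp
    | succ r ihr =>
      rw [sum_range_succ, ← add_assoc, ← ihr, card_labelingsOfIndex_succ hm, Nat.cast_add]
      congr 1
      have := inclusion_exclusion_card_biUnion ({e | m e ≠ 0} : Finset E)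
        (fun e => labelingsOfIndex (insert e Z) (r + 1))
      rw [← Int.cast_natCast, this, Int.cast_sum, Polynomial.eval_finsetSum]
      refine sum_congr rfl fun t _ => ?_
      have ht := mem_filter.1 t.2
      have hinf : t.1.inf' ht.2 (fun e => labelingsOfIndex (insert e Z) (r + 1)) =
          labelingsOfIndex (t.1 ∪ Z) (r + 1) := by
        ext L
        simp only [mem_inf', mem_labelingsOfIndex, forall_mem_insert, forall_mem_union]
        obtain ⟨e, he⟩ := ht.2
        exact ⟨fun h => ⟨(h e he).1, fun i hi => (h i hi).2.1, (h e he).2.2⟩,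
          fun h i hi => ⟨h.1, h.2.1 i hi, h.2.2⟩⟩
      have := hP t.1 ht.2 (mem_powerset.1 ht.1) r
      rw [← hinf] at this
      rw [hinf] at this
      rw [Polynomial.eval_mul, ← this, hinf]
      simp
  · refine ⟨0, fun r => ?_⟩
    rw [Polynomial.eval_zero, Nat.cast_eq_zero, card_eq_zero, eq_empty_iff_forall_notMem]
    intro L hL
    rw [mem_labelingsOfIndex] at hL
    obtain ⟨m, hm, h₁⟩ := hE.exists_le_vsum_eq_one r.succ_pos hL.1
    exact hZ ⟨m, mem_labelingsOfIndex.2 ⟨h₁, fun z hz =>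
      Nat.le_zero.1 ((hm z).trans (hL.2 z hz).le)⟩⟩

/-- If `e` attains the maximum in every labeling of index `2`, then its label is the index. -/
theorem IsBipartite.apply_eq_of_forall_eq_maxLabel (hE : IsBipartite E) {e : E}
    (hmax : ∀ L : E → ℕ, (∀ v : V, vsum E L v = 2) → L e = maxLabel E L) {r : ℕ} {L : E → ℕ}
    (hL : ∀ v, vsum E L v = r) : L e = r := by
  induction r generalizing L with
  | zero => exact Nat.le_zero.1 (le_of_vsum_eq hL e)
  | succ r ih =>
    obtain ⟨m, hm, h₁⟩ := hE.exists_le_vsum_eq_one r.succ_pos hL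
    have hme : m e ≠ 0 := by
      intro h
      have h₂ := hmax (m + m) fun v => by rw [vsum_add, h₁]
      have h₃ : ∀ i, m i = 0 := by
        intro i
        have : (m + m) i ≤ maxLabel E (m + m) := le_sup (f := m + m) (mem_attach E i)
        rw [← h₂] at this
        simpa [h] using this
      have := h₁ (Quot.out e.1).1
      simp [vsum, h₃] at this
    have h₄ : L e - m e = r := by
      refine ih (L := L - m) fun v => ?_
      have := vsum_add (L - m) m v
      rw [tsub_add_cancel_of_le hm, hL, h₁] at this
      omega
    have h₅ : L e ≤ r + 1 := le_of_vsum_eq hL e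
    have h₆ : m e ≤ L e := hm e
    omega

end Labelings

/-- If `G` is bipartite and some edge `e` attains the maximum label in every magic
labeling of index `2`, then `M_G` is a polynomial. -/
theorem magicCount_polynomial_of_bipartite {V : Type} [Fintype V] [DecidableEq V]
    (E : Finset (Sym2 V)) (hbip : IsBipartite E) (e : Sym2 V) (he : e ∈ E)
    (hmax : ∀ L : ↥E → ℕ, (∀ v : V, vsum E L v = 2) → L ⟨e, he⟩ = maxLabel E L) :
    ∃ p : Polynomial ℚ, ∀ k : ℕ, (magicCount E k : ℚ) = p.eval (k : ℚ) := by
  classical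
  have hcount : ∀ k, magicCount E k =
      ∑ r ∈ range (k + 1), #(labelingsOfIndex (∅ : Finset E) r) := by
    intro k
    rw [← card_biUnion, magicCount, ← Set.ncard_coe_finset]
    · congr 1
      ext L
      simp only [Set.mem_ofPred_eq, coe_biUnion, Set.mem_iUnion, mem_coe, mem_range,
        mem_labelingsOfIndex, notMem_empty, false_imp_iff, implies_true, and_true, exists_prop]
      constructor
      · rintro ⟨h₁, h₂⟩
        have h₃ := fun v => h₁ v (Quot.out e).1
        refine ⟨_, ?_, h₃⟩
        rw [← hbip.apply_eq_of_forall_eq_maxLabel hmax h₃]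
        exact Nat.lt_succ_of_le (h₂ _)
      · rintro ⟨r, hr, h⟩
        exact ⟨fun v w => (h v).trans (h w).symm,
          fun i => (le_of_vsum_eq h i).trans (Nat.le_of_lt_succ hr)⟩
    · intro r _ s _ hrs
      refine disjoint_left.2 fun L h₁ h₂ => hrs ?_
      rw [mem_labelingsOfIndex] at h₁ h₂
      exact (h₁.1 (Quot.out e).1).symm.trans (h₂.1 _)
  obtain ⟨q, hq⟩ := hbip.exists_polynomial_card_labelingsOfIndex (∅ : Finset E)
  obtain ⟨p, hp⟩ := q.exists_eval_eq_sum_range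
  refine ⟨p + Polynomial.C (#(labelingsOfIndex (∅ : Finset E) 0) : ℚ), fun k => ?_⟩
  rw [hcount, sum_range_succ', Polynomial.eval_add, Polynomial.eval_C, hp]
  push_cast [hq]
  rfl
end

section
/- Let G be a graph possessing a leaf, i.e., a vertex incident to exactly one edge. Then M_G is a quasipolynomial admitting 2 as a quasiperiod. If moreover G is bipartite, then M_G is a polynomial. -/
open Finset

theorem exists_polynomial_of_difference (h : ℕ → ℚ) (p : Polynomial ℚ)
    (hp : ∀ n : ℕ, h (n + 1) = h n + p.eval (n : ℚ)) :
    ∃ P : Polynomial ℚ, ∀ n : ℕ, h n = P.eval (n : ℚ) := by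
  have key : ∀ p : Polynomial ℚ, ∃ P : Polynomial ℚ, ∀ n : ℕ,
      ∑ i ∈ range n, p.eval (i : ℚ) = P.eval (n : ℚ) := by
    intro p
    induction p using Polynomial.induction_on' with
    | add p q hp hq =>
      obtain ⟨P, hP⟩ := hp
      obtain ⟨Q, hQ⟩ := hq
      exact ⟨P + Q, fun n => by simp [sum_add_distrib, hP, hQ]⟩
    | monomial m a =>
      refine ⟨∑ i ∈ range (m + 1), Polynomial.C (a * (bernoulli i * (m + 1).choose i / (m + 1))) *
        Polynomial.X ^ (m + 1 - i), fun n => ?_⟩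
      simp only [Polynomial.eval_monomial, ← mul_sum, sum_range_pow, Polynomial.eval_finsetSum,
        Polynomial.eval_mul, Polynomial.eval_C, Polynomial.eval_pow, Polynomial.eval_X]
      rw [mul_sum]
      exact sum_congr rfl fun i _ => by ring
  obtain ⟨P, hP⟩ := key p
  refine ⟨Polynomial.C (h 0) + P, fun n => ?_⟩
  rw [Polynomial.eval_add, Polynomial.eval_C, ← hP]
  induction n with
  | zero => simp
  | succ n ih => rw [hp, ih, sum_range_succ]; ring

/-- `f` agrees with a polynomial along every progression of difference `m` with positive start. -/
def PolyOnProgressions (m : ℕ) (f : ℕ → ℚ) : Prop :=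
  ∀ a : ℕ, 0 < a → ∃ p : Polynomial ℚ, ∀ n : ℕ, f (a + m * n) = p.eval (n : ℚ)

theorem PolyOnProgressions.add {m : ℕ} {f g : ℕ → ℚ} (hf : PolyOnProgressions m f)
    (hg : PolyOnProgressions m g) : PolyOnProgressions m (fun r => f r + g r) := by
  intro a ha
  obtain ⟨p, hp⟩ := hf a ha
  obtain ⟨q, hq⟩ := hg a ha
  exact ⟨p + q, fun n => by simp [hp, hq]⟩

theorem PolyOnProgressions.sub {m : ℕ} {f g : ℕ → ℚ} (hf : PolyOnProgressions m f)
    (hg : PolyOnProgressions m g) : PolyOnProgressions m (fun r => f r - g r) := by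
  intro a ha
  obtain ⟨p, hp⟩ := hf a ha
  obtain ⟨q, hq⟩ := hg a ha
  exact ⟨p - q, fun n => by simp [hp, hq]⟩

theorem le_of_vertex_sum {V : Type} [Fintype V] {y : Sym2 V → ℕ} {r : ℕ}
    (h : ∀ v, ∑ w, y s(v, w) = r) (e : Sym2 V) :
    y e ≤ r := by
  induction e using Sym2.ind with
  | _ u w =>
    rw [← h u]
    exact single_le_sum (f := fun w => y s(u, w)) (fun _ _ => Nat.zero_le _) (mem_univ w)

section Labelings

variable {V : Type} [Fintype V] [DecidableEq V]

/-- The labelings supported on `S`, congruent to `η` modulo `q`, with all vertex sums `r`. -/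
def regularLabelings (S : Finset (Sym2 V)) (q : ℕ) (η : Sym2 V → ℤ) (r : ℕ) :
    Finset (Sym2 V → ℕ) :=
  {y ∈ Finset.Icc 0 (fun _ => r) | (∀ e, e ∉ S → y e = 0) ∧ (∀ v, ∑ w, y s(v, w) = r) ∧
    ∀ e, (y e : ℤ) ≡ η e [ZMOD q]}

theorem mem_regularLabelings {S : Finset (Sym2 V)} {q : ℕ} {η : Sym2 V → ℤ} {r : ℕ}
    {y : Sym2 V → ℕ} : y ∈ regularLabelings S q η r ↔
      (∀ e, e ∉ S → y e = 0) ∧ (∀ v, ∑ w, y s(v, w) = r) ∧ ∀ e, (y e : ℤ) ≡ η e [ZMOD q] := by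
  rw [regularLabelings, mem_filter, and_iff_right_iff_imp]
  rintro ⟨-, h, -⟩
  exact mem_Icc.2 ⟨fun _ => Nat.zero_le _, fun e => le_of_vertex_sum h e⟩

theorem filter_eq_zero_regularLabelings {S : Finset (Sym2 V)} {q : ℕ} {η : Sym2 V → ℤ} {r : ℕ}
    (e : Sym2 V) : {y ∈ regularLabelings S q η r | y e = 0} =
      regularLabelings (S.erase e) q η r := by
  ext y
  simp only [mem_filter, mem_regularLabelings, mem_erase]
  constructor
  · rintro ⟨⟨h1, h2⟩, h3⟩
    refine ⟨fun f hf => ?_, h2⟩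
    by_cases hfe : f = e
    · rwa [hfe]
    · exact h1 f fun h => hf ⟨hfe, h⟩
  · rintro ⟨h1, h2⟩
    exact ⟨⟨fun f hf => h1 f fun h => hf h.2, h2⟩, h1 e fun h => h.1 rfl⟩

theorem polyOnProgressions_exists_eq_zero {m q : ℕ} {η : Sym2 V → ℤ} (T S : Finset (Sym2 V))
    (hTS : T ⊆ S)
    (ih : ∀ S' ⊂ S, PolyOnProgressions m fun r => (#(regularLabelings S' q η r) : ℚ)) :
    PolyOnProgressions m fun r =>
      (#{y ∈ regularLabelings S q η r | ∃ e ∈ T, y e = 0} : ℚ) := by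
  induction T using Finset.induction_on generalizing S with
  | empty => exact fun a _ => ⟨0, by simp⟩
  | insert e T he hT =>
    have heS : e ∈ S := hTS (mem_insert_self e T)
    have h1 := hT S ((subset_insert e T).trans hTS) ih
    have h2 := ih _ (erase_ssubset heS)
    have h3 := hT (S.erase e)
      (fun f hf => mem_erase.2 ⟨fun h => he (h ▸ hf), hTS (mem_insert_of_mem hf)⟩)
      (fun S' hS' => ih S' (hS'.trans (erase_ssubset heS)))
    convert (h1.add h2).sub h3 using 2 with r
    rw [← filter_eq_zero_regularLabelings, filter_filter, eq_sub_iff_add_eq]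
    norm_cast
    have h := card_union_add_card_inter {y ∈ regularLabelings S q η r | ∃ e ∈ T, y e = 0}
      {y ∈ regularLabelings S q η r | y e = 0}
    rw [← filter_or, ← filter_and] at h
    rw [← h]
    congr 2
    · ext y
      simp only [mem_filter, exists_mem_insert]
      rw [or_comm]
    · ext y
      simp only [mem_filter]
      tauto

/-- Subtracting the largest possible multiple of `P` partitions the labelings of sum `r + d * q`
into a copy of those of sum `r` and labelings vanishing somewhere on the support of `P`. -/
theorem card_regularLabelings_add {S : Finset (Sym2 V)} {q d : ℕ} (hd : 0 < d)
    (η : Sym2 V → ℤ) {P : Sym2 V → ℕ} (hPS : ∀ e, e ∉ S → P e = 0)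
    (hP : ∀ v, ∑ w, P s(v, w) = d) (hPd : ∀ e, P e ≠ 0 → P e ∣ d)
    (hT : {e ∈ S | P e ≠ 0}.Nonempty) (r : ℕ) :
    #(regularLabelings S q η (r + d * q)) = #(regularLabelings S q η r) +
      ∑ σ ∈ range (d * q),
        #{z ∈ regularLabelings S (d * q) (fun e => d * η e - σ * P e) (d * (r + d * q - σ)) |
          ∃ e ∈ {e ∈ S | P e ≠ 0}, z e = 0} := by
  set T := {e ∈ S | P e ≠ 0} with hTdef
  have hmemT : ∀ e, P e ≠ 0 → e ∈ T := fun e he =>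
    mem_filter.2 ⟨by_contra fun h => he (hPS e h), he⟩
  let s : (Sym2 V → ℕ) → ℕ := fun y => T.inf' hT fun e => d * y e / P e
  have hs_le : ∀ y k, k ≤ s y ↔ ∀ e, k * P e ≤ d * y e := by
    intro y k
    rw [le_inf'_iff]
    constructor
    · intro h e
      by_cases he : P e = 0
      · simp [he]
      · exact (Nat.le_div_iff_mul_le (Nat.pos_of_ne_zero he)).1 (h e (hmemT e he))
    · intro h e he
      exact (Nat.le_div_iff_mul_le (Nat.pos_of_ne_zero (mem_filter.1 he).2)).2 (h e)
  have hs_eq : ∀ y, ∃ e ∈ T, d * y e = s y * P e := by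
    intro y
    obtain ⟨e, he, h⟩ := exists_mem_eq_inf' hT fun e => d * y e / P e
    refine ⟨e, he, ?_⟩
    change s y = _ at h
    rw [h, Nat.div_mul_cancel ((hPd e (mem_filter.1 he).2).mul_right _)]
  rw [card_eq_sum_card_fiberwise (f := fun y => min (s y) (d * q)) (t := range (d * q + 1))
    (fun y _ => by simp), sum_range_succ, add_comm]
  congr 1
  · symm
    refine card_bij (fun y _ e => y e + q * P e) ?_ ?_ ?_
    · intro y hy
      obtain ⟨h1, h2, h3⟩ := mem_regularLabelings.1 hy
      refine mem_filter.2 ⟨mem_regularLabelings.2 ⟨?_, ?_, ?_⟩, ?_⟩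
      · intro e he
        simp [h1 e he, hPS e he]
      · intro v
        rw [sum_add_distrib, ← mul_sum, h2, hP, mul_comm]
      · intro e
        push_cast
        have := (h3 e).add (Int.modEq_zero_iff_dvd.2 (dvd_mul_right (q : ℤ) (P e)))
        simpa using this
      · rw [min_eq_right_iff, hs_le]
        intro e
        rw [mul_assoc]
        exact Nat.mul_le_mul_left d (Nat.le_add_left _ _)
    · intro y _ z _ h
      funext e
      have := congrFun h e
      simpa using this
    · intro y hy
      obtain ⟨hy, hmin⟩ := mem_filter.1 hy
      obtain ⟨h1, h2, h3⟩ := mem_regularLabelings.1 hy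
      rw [min_eq_right_iff, hs_le] at hmin
      have hle : ∀ e, q * P e ≤ y e := fun e =>
        Nat.le_of_mul_le_mul_left (by rw [← mul_assoc]; exact hmin e) hd
      choose x hx using fun e => Nat.exists_eq_add_of_le' (hle e)
      refine ⟨x, mem_regularLabelings.2 ⟨?_, ?_, ?_⟩, (funext hx).symm⟩
      · intro e he
        have := hx e
        rw [h1 e he] at this
        lia
      · intro v
        have := h2 v
        simp only [hx, sum_add_distrib, ← mul_sum, hP] at this
        rw [mul_comm q d] at this
        exact Nat.add_right_cancel this
      · intro e
        have := h3 e
        rw [hx e] at this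
        push_cast at this
        have := this.sub (Int.modEq_zero_iff_dvd.2 (dvd_mul_right (q : ℤ) (P e)))
        simpa using this
  · refine sum_congr rfl fun σ hσ => ?_
    rw [mem_range] at hσ
    have hmin : ∀ y, min (s y) (d * q) = σ ↔ s y = σ := by intro y; lia
    simp only [hmin]
    refine card_bij (fun y _ e => d * y e - σ * P e) ?_ ?_ ?_
    · intro y hy
      obtain ⟨hy, hsy⟩ := mem_filter.1 hy
      obtain ⟨h1, h2, h3⟩ := mem_regularLabelings.1 hy
      have hle := (hs_le y σ).1 hsy.ge
      refine mem_filter.2 ⟨mem_regularLabelings.2 ⟨?_, ?_, ?_⟩, ?_⟩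
      · intro e he
        simp [h1 e he]
      · intro v
        rw [sum_tsub_distrib _ fun w _ => hle _, ← mul_sum, ← mul_sum, h2, hP, mul_comm σ,
          ← Nat.mul_sub]
      · intro e
        rw [Nat.cast_sub (hle e)]
        push_cast
        exact ((h3 e).mul_left').sub_right _
      · obtain ⟨e, he, h⟩ := hs_eq y
        exact ⟨e, he, by simp [h, hsy]⟩
    · intro y hy z hz h
      have hy' := (hs_le y σ).1 (mem_filter.1 hy).2.ge
      have hz' := (hs_le z σ).1 (mem_filter.1 hz).2.ge
      funext e
      have := congrFun h e
      have h1 := hy' e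
      have h2 := hz' e
      exact Nat.eq_of_mul_eq_mul_left hd (by lia)
    · intro z hz
      obtain ⟨hz, e₀, he₀, hze₀⟩ := mem_filter.1 hz
      obtain ⟨h1, h2, h3⟩ := mem_regularLabelings.1 hz
      have hmod : ∀ e, ((z e + σ * P e : ℕ) : ℤ) ≡ d * η e [ZMOD ((d * q : ℕ) : ℤ)] := by
        intro e
        have := (h3 e).add_right (σ * P e)
        push_cast at this ⊢
        simpa using this
      have hdvd : ∀ e, d ∣ z e + σ * P e := by
        intro e
        have h := (hmod e).of_dvd (m := (d : ℤ)) (by push_cast; exact dvd_mul_right _ _)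
        have := h.trans (Int.modEq_zero_iff_dvd.2 (dvd_mul_right _ _))
        exact Int.natCast_dvd_natCast.1 (Int.modEq_zero_iff_dvd.1 this)
      choose y hy using hdvd
      refine ⟨y, mem_filter.2 ⟨mem_regularLabelings.2 ⟨?_, ?_, ?_⟩, ?_⟩, ?_⟩
      · intro e he
        have := hy e
        simp only [h1 e he, hPS e he] at this
        simpa [hd.ne'] using this
      · intro v
        refine Nat.eq_of_mul_eq_mul_left hd ?_
        rw [mul_sum]
        simp only [← hy, sum_add_distrib, ← mul_sum, h2, hP]
        rw [mul_comm σ, ← mul_add, Nat.sub_add_cancel (by lia)]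
      · intro e
        have := hmod e
        rw [hy e] at this
        push_cast at this
        exact this.mul_left_cancel' (by exact_mod_cast hd.ne')
      · refine le_antisymm ?_ ((hs_le y σ).2 fun e => by rw [← hy]; exact Nat.le_add_left _ _)
        have := (hs_le y (s y)).1 le_rfl e₀
        rw [← hy, hze₀, zero_add] at this
        exact Nat.le_of_mul_le_mul_right this (Nat.pos_of_ne_zero (mem_filter.1 he₀).2)
      · funext e
        simp [← hy]

/-- If every subset of `E` carrying a regular labeling of positive sum carries one of sum `d`
with labels dividing `d`, then the number of regular labelings is polynomial on progressions. -/
theorem polyOnProgressions_regularLabelings [Nonempty V] {E : Finset (Sym2 V)} {d : ℕ} (hd : 0 < d)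
    (hE : ∀ S ⊆ E, ∀ r, 0 < r → ∀ y : Sym2 V → ℕ, (∀ e, e ∉ S → y e = 0) →
      (∀ v, ∑ w, y s(v, w) = r) → ∃ P : Sym2 V → ℕ, (∀ e, e ∉ S → P e = 0) ∧
        (∀ v, ∑ w, P s(v, w) = d) ∧ ∀ e, P e ≠ 0 → P e ∣ d)
    (S : Finset (Sym2 V)) (hS : S ⊆ E) (q : ℕ) (η : Sym2 V → ℤ) :
    PolyOnProgressions (d * q) fun r => (#(regularLabelings S q η r) : ℚ) := by
  induction S using Finset.strongInduction generalizing q η with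
  | H S ih =>
    by_cases hP : ∃ P : Sym2 V → ℕ, (∀ e, e ∉ S → P e = 0) ∧
        (∀ v, ∑ w, P s(v, w) = d) ∧ ∀ e, P e ≠ 0 → P e ∣ d
    · obtain ⟨P, hPS, hPv, hPd⟩ := hP
      have hT : {e ∈ S | P e ≠ 0}.Nonempty := by
        obtain ⟨v⟩ := ‹Nonempty V›
        obtain ⟨w, -, hw⟩ := exists_ne_zero_of_sum_ne_zero ((hPv v).trans_ne hd.ne')
        exact ⟨s(v, w), mem_filter.2 ⟨by_contra fun h => hw (hPS _ h), hw⟩⟩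
      intro a _
      have hpoly : ∀ σ ∈ range (d * q), ∃ p : Polynomial ℚ, ∀ n : ℕ,
          (#{z ∈ regularLabelings S (d * q) (fun e => d * η e - σ * P e)
            (d * (a + d * q * n + d * q - σ)) | ∃ e ∈ {e ∈ S | P e ≠ 0}, z e = 0} : ℚ) =
            p.eval (n : ℚ) := by
        intro σ hσ
        rw [mem_range] at hσ
        obtain ⟨p, hp⟩ := polyOnProgressions_exists_eq_zero (m := d * (d * q)) (q := d * q)
          (η := fun e => d * η e - σ * P e) {e ∈ S | P e ≠ 0} S (filter_subset _ _)
          (fun S' hS' => ih S' hS' (hS'.subset.trans hS) _ _)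
          (d * (a + d * q - σ)) (Nat.mul_pos hd (by lia))
        refine ⟨p, fun n => ?_⟩
        rw [← hp]
        have : d * (a + d * q * n + d * q - σ) = d * (a + d * q - σ) + d * (d * q) * n := by
          rw [mul_assoc d (d * q), ← mul_add]
          congr 1
          lia
        rw [this]
      choose! p hp using hpoly
      refine exists_polynomial_of_difference _ (∑ σ ∈ range (d * q), p σ) fun n => ?_
      beta_reduce
      rw [mul_add, mul_one, ← add_assoc, card_regularLabelings_add hd η hPS hPv hPd hT,
        Polynomial.eval_finsetSum]
      push_cast
      congr 1
      exact sum_congr rfl fun σ hσ => hp σ hσ n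
    · intro a ha
      refine ⟨0, fun n => ?_⟩
      rw [Polynomial.eval_zero, Nat.cast_eq_zero, card_eq_zero, eq_empty_iff_forall_notMem]
      intro y hy
      obtain ⟨h1, h2, -⟩ := mem_regularLabelings.1 hy
      exact hP (hE S hS _ (Nat.add_pos_left ha _) y h1 h2)

end Labelings

/-- A symmetric labeling with constant positive vertex sums has a permutation in its support. -/
theorem exists_perm_of_vertex_sum {V : Type} [Fintype V] [DecidableEq V] {y : Sym2 V → ℕ} {r : ℕ}
    (hr : 0 < r) (hy : ∀ v, ∑ w, y s(v, w) = r) :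
    ∃ σ : Equiv.Perm V, ∀ v, y s(v, σ v) ≠ 0 := by
  have hr' : (r : ℚ) ≠ 0 := by exact_mod_cast hr.ne'
  have hrow : ∀ v, ∑ w, (y s(v, w) : ℚ) / r = 1 := by
    intro v
    rw [← sum_div, div_eq_one_iff_eq hr']
    exact_mod_cast hy v
  have hM : Matrix.of (fun u v => (y s(u, v) : ℚ) / r) ∈ doublyStochastic ℚ V := by
    refine mem_doublyStochastic_iff_sum.2 ⟨fun u v => ?_, hrow, fun v => ?_⟩
    · simp only [Matrix.of_apply]
      positivity
    · simp only [Matrix.of_apply, Sym2.eq_swap (b := v)]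
      exact hrow v
  obtain ⟨w, hw, hsum, hwM⟩ := exists_eq_sum_perm_of_mem_doublyStochastic hM
  obtain ⟨σ, -, hσ⟩ := exists_ne_zero_of_sum_ne_zero (hsum.trans_ne one_ne_zero)
  refine ⟨σ, fun v h => ?_⟩
  have hentry := congrFun (congrFun hwM v) (σ v)
  rw [Matrix.sum_apply] at hentry
  have hle := single_le_sum (f := fun τ : Equiv.Perm V => (w τ • τ.permMatrix ℚ) v (σ v))
    (fun τ _ => by
      simp only [Matrix.smul_apply, smul_eq_mul, PEquiv.toMatrix_apply]
      exact mul_nonneg (hw τ) (by split_ifs <;> norm_num)) (mem_univ σ)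
  rw [hentry] at hle
  simp [h, Equiv.toPEquiv_apply] at hle
  exact hσ (le_antisymm hle (hw σ))

theorem exists_two_regular {V : Type} [Fintype V] [DecidableEq V] (S : Finset (Sym2 V)) (r : ℕ)
    (hr : 0 < r) (y : Sym2 V → ℕ) (hyS : ∀ e, e ∉ S → y e = 0) (hy : ∀ v, ∑ w, y s(v, w) = r) :
    ∃ P : Sym2 V → ℕ, (∀ e, e ∉ S → P e = 0) ∧ (∀ v, ∑ w, P s(v, w) = 2) ∧
      ∀ e, P e ≠ 0 → P e ∣ 2 := by
  obtain ⟨σ, hσ⟩ := exists_perm_of_vertex_sum hr hy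
  have hsum : ∀ v, ∑ w, ((if σ v = w then 1 else 0) + if σ w = v then 1 else 0) = 2 := by
    intro v
    simp [sum_add_distrib, fun w => (σ.eq_symm_apply (x := v) (y := w)).symm]
  let P : Sym2 V → ℕ := Sym2.lift ⟨fun u v => (if σ u = v then 1 else 0) +
    if σ v = u then 1 else 0, fun u v => add_comm _ _⟩
  refine ⟨P, fun e he => ?_, hsum, fun e he => ?_⟩
  · induction e using Sym2.ind with
    | _ u v =>
      have h1 : σ u ≠ v := fun h => hσ u (h ▸ hyS _ he)
      have h2 : σ v ≠ u := fun h => hσ v (by rw [h, Sym2.eq_swap]; exact hyS _ he)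
      simp [P, h1, h2]
  · have : P e ≤ 2 := le_of_vertex_sum (y := P) hsum e
    interval_cases P e <;> simp_all

theorem IsBipartite.exists_one_regular {V : Type} [Fintype V] [DecidableEq V]
    {E : Finset (Sym2 V)} (hE : IsBipartite E) (S : Finset (Sym2 V)) (hSE : S ⊆ E) (r : ℕ)
    (hr : 0 < r) (y : Sym2 V → ℕ) (hyS : ∀ e, e ∉ S → y e = 0) (hy : ∀ v, ∑ w, y s(v, w) = r) :
    ∃ P : Sym2 V → ℕ, (∀ e, e ∉ S → P e = 0) ∧ (∀ v, ∑ w, P s(v, w) = 1) ∧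
      ∀ e, P e ≠ 0 → P e ∣ 1 := by
  classical
  obtain ⟨σ, hσ⟩ := exists_perm_of_vertex_sum hr hy
  obtain ⟨A, hA⟩ := hE
  have hσA : ∀ v, σ v ∈ A ↔ v ∉ A := by
    intro v
    obtain ⟨a, b, hab, ha, hb⟩ := hA _ (hSE (by_contra fun h => hσ v (hyS _ h)))
    rcases Sym2.eq_iff.1 hab with ⟨h1, h2⟩ | ⟨h1, h2⟩ <;> rw [h2, h1] <;> simp [ha, hb]
  have hsum : ∀ v, ∑ w, ((if v ∈ A ∧ σ v = w then 1 else 0) +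
      if w ∈ A ∧ σ w = v then 1 else 0) = 1 := by
    intro v
    have hv := hσA (σ.symm v)
    rw [Equiv.apply_symm_apply] at hv
    have h2 : ∀ w, (w ∈ A ∧ σ w = v) ↔ w = σ.symm v ∧ v ∉ A := by
      intro w
      rw [← σ.eq_symm_apply]
      constructor
      · rintro ⟨hw, rfl⟩
        exact ⟨rfl, fun h => hv.1 h hw⟩
      · rintro ⟨rfl, h⟩
        exact ⟨by_contra fun h' => h (hv.2 h'), rfl⟩
    simp only [h2]
    by_cases h : v ∈ A <;> simp [h]
  let P : Sym2 V → ℕ := Sym2.lift ⟨fun u v => (if u ∈ A ∧ σ u = v then 1 else 0) +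
    if v ∈ A ∧ σ v = u then 1 else 0, fun u v => add_comm _ _⟩
  refine ⟨P, fun e he => ?_, hsum, fun e he => ?_⟩
  · induction e using Sym2.ind with
    | _ u v =>
      have h1 : σ u ≠ v := fun h => hσ u (h ▸ hyS _ he)
      have h2 : σ v ≠ u := fun h => hσ v (by rw [h, Sym2.eq_swap]; exact hyS _ he)
      simp [P, h1, h2]
  · exact Nat.dvd_one.2 (le_antisymm (le_of_vertex_sum (y := P) hsum e) (Nat.one_le_iff_ne_zero.2 he))

section Magic

variable {V : Type} [DecidableEq V] {E : Finset (Sym2 V)}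

/-- Extension of an edge labeling by zero to all pairs. -/
def extendZero (L : E → ℕ) (e : Sym2 V) : ℕ :=
  if h : e ∈ E then L ⟨e, h⟩ else 0

theorem extendZero_coe (L : E → ℕ) (e : E) : extendZero L e = L e := by
  simp [extendZero]

theorem extendZero_injective : Function.Injective (extendZero : (E → ℕ) → Sym2 V → ℕ) := by
  intro L L' h
  funext e
  rw [← extendZero_coe L, h, extendZero_coe]

theorem sum_extendZero [Fintype V] (L : E → ℕ) (v : V) :
    ∑ w, extendZero L s(v, w) = vsum E L v := by
  have h1 : vsum E L v = ∑ e ∈ E, if v ∈ e then extendZero L e else 0 := by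
    rw [vsum, ← sum_attach E]
    simp only [extendZero_coe]
  have h2 : ∑ w, extendZero L s(v, w) = ∑ e ∈ univ.image fun w => s(v, w), extendZero L e :=
    (sum_image fun a _ b _ h => Sym2.congr_right.1 h).symm
  rw [h1, h2, ← sum_filter]
  symm
  refine sum_subset_zero_on_sdiff (fun e he => ?_) (fun e he => ?_) fun _ _ => rfl
  · obtain ⟨w, rfl⟩ := (mem_filter.1 he).2
    exact mem_image_of_mem _ (mem_univ w)
  · rw [mem_sdiff, mem_image, mem_filter] at he
    obtain ⟨⟨w, -, rfl⟩, h⟩ := he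
    exact dif_neg fun hE => h ⟨hE, Sym2.mem_mk_left v w⟩

theorem magicCount_eq_sum [Fintype V] (hleaf : ∃ v : V, ∃! e, e ∈ E ∧ v ∈ e) (k : ℕ) :
    magicCount E k = ∑ r ∈ range (k + 1), #(regularLabelings E 1 0 r) := by
  obtain ⟨v, e₀, ⟨he₀, hv⟩, huniq⟩ := hleaf
  have hleafsum : ∀ L : E → ℕ, vsum E L v = L ⟨e₀, he₀⟩ := by
    intro L
    rw [vsum, sum_eq_single ⟨e₀, he₀⟩]
    · simp [hv]
    · rintro ⟨e, he⟩ - hne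
      exact if_neg fun h => hne (Subtype.ext (huniq e ⟨he, h⟩))
    · simp
  rw [magicCount, ← Set.ncard_image_of_injective _ extendZero_injective, ← card_biUnion]
  · rw [← Set.ncard_coe_finset]
    congr 1
    ext y
    simp only [Set.mem_image, Set.mem_ofPred_eq, coe_biUnion, Set.mem_iUnion, mem_coe, mem_range,
      mem_regularLabelings, Nat.cast_one, Int.modEq_one, implies_true, and_true, exists_prop,
      Order.lt_add_one_iff]
    constructor
    · rintro ⟨L, ⟨hL, hk⟩, rfl⟩
      refine ⟨L ⟨e₀, he₀⟩, hk _, fun e he => dif_neg he, fun u => ?_⟩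
      rw [sum_extendZero, hL u v, hleafsum]
    · rintro ⟨r, hr, h1, h2⟩
      have hy : extendZero (fun e : E => y e) = y := by
        funext e
        by_cases he : e ∈ E
        · simp [extendZero, he]
        · simp [extendZero, he, h1]
      refine ⟨fun e => y e, ⟨fun u w => ?_, fun e => (le_of_vertex_sum h2 e).trans hr⟩, hy⟩
      rw [← sum_extendZero, ← sum_extendZero, hy, h2, h2]
  · intro r _ r' _ hne
    refine disjoint_left.2 fun y hy hy' => hne ?_
    rw [← (mem_regularLabelings.1 hy).2.1 v, (mem_regularLabelings.1 hy').2.1 v]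

theorem exists_polynomial_magicCount [Fintype V] (hleaf : ∃ v : V, ∃! e, e ∈ E ∧ v ∈ e) {d : ℕ}
    (hd : PolyOnProgressions d fun r => (#(regularLabelings E 1 0 r) : ℚ)) (a : ℕ) :
    ∃ p : Polynomial ℚ, ∀ n : ℕ, (magicCount E (a + d * n) : ℚ) = p.eval (n : ℚ) := by
  choose p hp using fun i : ℕ => hd (a + i + 1) (by lia)
  refine exists_polynomial_of_difference _ (∑ i ∈ range d, p i) fun n => ?_
  simp only [magicCount_eq_sum hleaf]
  rw [show a + d * (n + 1) + 1 = a + d * n + 1 + d by ring, sum_range_add, Nat.cast_add,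
    Polynomial.eval_finsetSum, Nat.cast_sum (range d)]
  congr 1
  refine sum_congr rfl fun i _ => ?_
  rw [← hp]
  congr 3
  ring

end Magic

/-- If `G` has a leaf (a vertex incident to exactly one edge), then `M_G` is a
quasipolynomial admitting `2` as a quasiperiod; if moreover `G` is bipartite, then
`M_G` is a polynomial. -/
theorem magicCount_of_leaf {V : Type} [Fintype V] [DecidableEq V]
    (E : Finset (Sym2 V)) (hleaf : ∃ v : V, ∃! e, e ∈ E ∧ v ∈ e) :
    IsQuasiPoly (fun k => (magicCount E k : ℚ)) 2 ∧
    (IsBipartite E → ∃ p : Polynomial ℚ, ∀ k : ℕ, (magicCount E k : ℚ) = p.eval (k : ℚ)) := by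
  have : Nonempty V := ⟨hleaf.choose⟩
  refine ⟨⟨two_pos, ?_⟩, fun hE => ?_⟩
  · choose p hp using exists_polynomial_magicCount hleaf (polyOnProgressions_regularLabelings
      two_pos (fun S _ => exists_two_regular S) E Subset.rfl 1 0)
    refine ⟨fun a => (p a).comp (Polynomial.C (1 / 2) * (Polynomial.X - Polynomial.C (a : ℚ))),
      fun t => ?_⟩
    have h := hp (t % 2) (t / 2)
    rw [mul_one, Nat.mod_add_div] at h
    have ht : (t : ℚ) = (t % 2 : ℕ) + 2 * (t / 2 : ℕ) := by exact_mod_cast (Nat.mod_add_div t 2).symm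
    simp only [Polynomial.eval_comp, Polynomial.eval_mul, Polynomial.eval_C, Polynomial.eval_sub,
      Polynomial.eval_X]
    rw [h]
    congr 1
    rw [ht]
    ring
  · obtain ⟨p, hp⟩ := exists_polynomial_magicCount hleaf (polyOnProgressions_regularLabelings
      one_pos hE.exists_one_regular E Subset.rfl 1 0) 0
    exact ⟨p, fun k => by simpa using hp k⟩
end

section
/- Let G be a graph and e an edge of G such that L(e) = max(L) for every magic labeling L of G of index 2. Then L(e) = max(L) for every magic labeling L of G (of any index). -/
open Finset

/-- The index of a labeling at `v`, as a row sum of an extension by zero to all unordered pairs. -/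
theorem vsum_eq_sum_of_support {V : Type} [Fintype V] [DecidableEq V] (E : Finset (Sym2 V))
    (B : Sym2 V → ℕ) (hB : ∀ e, e ∉ E → B e = 0) (v : V) :
    vsum E (fun e => B e.1) v = ∑ u, B s(v, u) := by
  have h_inj : Function.Injective fun u : V => s(v, u) := fun a b h => Sym2.congr_right.1 h
  have h_image : (univ.filter fun e : Sym2 V => v ∈ e) = univ.image fun u => s(v, u) := by
    ext e
    simp only [mem_filter, mem_univ, true_and, mem_image, Sym2.mem_iff_exists, eq_comm]
  calc vsum E (fun e => B e.1) v = ∑ e ∈ E, if v ∈ e then B e else 0 :=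
        sum_attach E fun e => if v ∈ e then B e else 0
    _ = ∑ e, if v ∈ e then B e else 0 :=
        sum_subset (subset_univ E) fun e _ he => by simp [hB e he]
    _ = ∑ u, B s(v, u) := by
        rw [← sum_filter, h_image, sum_image h_inj.injOn]

/-- The sum of the permutation matrix of `σ` and its transpose, as a function on unordered pairs. -/
def permLabel {V : Type} [DecidableEq V] (σ : Equiv.Perm V) : Sym2 V → ℕ :=
  Sym2.lift ⟨fun u v => (if σ u = v then 1 else 0) + (if σ v = u then 1 else 0),
    fun _ _ => add_comm _ _⟩

theorem permLabel_mk {V : Type} [DecidableEq V] (σ : Equiv.Perm V) (u v : V) :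
    permLabel σ s(u, v) = (if σ u = v then 1 else 0) + (if σ v = u then 1 else 0) :=
  rfl

theorem sum_permLabel {V : Type} [Fintype V] [DecidableEq V] (σ : Equiv.Perm V) (v : V) :
    ∑ u, permLabel σ s(v, u) = 2 := by
  have h_preimage : ∀ u, σ u = v ↔ u = σ.symm v := fun u => (σ.eq_symm_apply).symm
  simp only [permLabel_mk, sum_add_distrib, h_preimage, sum_ite_eq, sum_ite_eq', mem_univ, if_true]

/-- Birkhoff's theorem for symmetric matrices with natural entries and constant row sums. -/
theorem exists_weights_permLabel {V : Type} [Fintype V] [DecidableEq V] (B : Sym2 V → ℕ)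
    {r : ℕ} (hr : r ≠ 0) (hB : ∀ v, ∑ u, B s(v, u) = r) :
    ∃ w : Equiv.Perm V → ℝ, (∀ σ, 0 ≤ w σ) ∧
      (∀ σ e, w σ ≠ 0 → permLabel σ e ≠ 0 → B e ≠ 0) ∧
      ∀ e, ∑ σ, w σ * permLabel σ e = 2 * ((B e : ℝ) / r) := by
  have hr' : (r : ℝ) ≠ 0 := by exact_mod_cast hr
  let M : Matrix V V ℝ := fun u v => (B s(u, v) : ℝ) / r
  have h_row : ∀ v, ∑ u, M v u = 1 := fun v => by
    simp only [M, ← sum_div, ← Nat.cast_sum, hB v, div_self hr']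
  have h_symm : ∀ u v, M u v = M v u := fun u v => by simp only [M, Sym2.eq_swap]
  have hM : M ∈ doublyStochastic ℝ V :=
    mem_doublyStochastic_iff_sum.2
      ⟨fun _ _ => by positivity, h_row, fun v => by simpa only [h_symm _ v] using h_row v⟩
  obtain ⟨w, h_nonneg, -, h_sum⟩ := exists_eq_sum_perm_of_mem_doublyStochastic hM
  have h_entry : ∀ u v, ∑ σ, w σ * (if σ u = v then 1 else 0) = (B s(u, v) : ℝ) / r := by
    intro u v
    have := congrFun (congrFun h_sum u) v
    simpa [Matrix.sum_apply, Equiv.Perm.permMatrix, PEquiv.toMatrix_apply, M, eq_comm] using this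
  have h_total : ∀ e, ∑ σ, w σ * permLabel σ e = 2 * ((B e : ℝ) / r) := by
    intro e
    induction e with | _ u v => ?_
    simp only [permLabel_mk, Nat.cast_add, Nat.cast_ite, Nat.cast_one, Nat.cast_zero, mul_add,
      sum_add_distrib, h_entry, Sym2.eq_swap (a := v)]
    ring
  refine ⟨w, h_nonneg, fun σ e hw hσ hBe => ?_, h_total⟩
  have h_zero := h_total e
  rw [hBe, Nat.cast_zero, zero_div, mul_zero,
    sum_eq_zero_iff_of_nonneg fun τ _ => mul_nonneg (h_nonneg τ) (Nat.cast_nonneg _)] at h_zero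
  exact mul_ne_zero hw (Nat.cast_ne_zero.2 hσ) (h_zero σ (mem_univ σ))

/-- If an edge `e` attains the maximum label in every magic labeling of index `2`,
then it attains the maximum label in every magic labeling. -/
theorem max_edge_of_index_two {V : Type} [Fintype V] [DecidableEq V]
    (E : Finset (Sym2 V)) (e : Sym2 V) (he : e ∈ E)
    (hmax : ∀ L : ↥E → ℕ, (∀ v : V, vsum E L v = 2) → L ⟨e, he⟩ = maxLabel E L) :
    ∀ L : ↥E → ℕ, IsMagic E L → L ⟨e, he⟩ = maxLabel E L := by
  intro L hL
  refine le_antisymm (le_sup (mem_attach E _)) (Finset.sup_le fun f _ => ?_)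
  let B : Sym2 V → ℕ := fun x => if h : x ∈ E then L ⟨x, h⟩ else 0
  have h_support : ∀ x, x ∉ E → B x = 0 := fun x hx => dif_neg hx
  have h_ext : (fun x : E => B x.1) = L := funext fun x => dif_pos x.2
  obtain ⟨v₀, hv₀⟩ : ∃ v, v ∈ f.1 := ⟨_, Sym2.out_fst_mem f.1⟩
  have h_row : ∀ v, ∑ u, B s(v, u) = vsum E L v₀ := fun v => by
    rw [← vsum_eq_sum_of_support E B h_support v, h_ext, hL v v₀]
  by_cases hr : vsum E L v₀ = 0
  · rw [vsum, sum_eq_zero_iff] at hr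
    have := hr f (mem_attach E f)
    rw [if_pos hv₀] at this
    exact this.trans_le (Nat.zero_le _)
  obtain ⟨w, h_nonneg, h_pos, h_total⟩ := exists_weights_permLabel B hr h_row
  have h_le : ∑ σ, w σ * permLabel σ f.1 ≤ ∑ σ, w σ * permLabel σ e := by
    refine sum_le_sum fun σ _ => ?_
    rcases eq_or_ne (w σ) 0 with hw | hw
    · simp [hw]
    refine mul_le_mul_of_nonneg_left (Nat.cast_le.2 ?_) (h_nonneg σ)
    have hσ : ∀ x, x ∉ E → permLabel σ x = 0 := fun x hx => by
      by_contra h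
      exact h_pos σ x hw h (h_support x hx)
    have h_max := hmax (fun x => permLabel σ x.1) fun v => by
      rw [vsum_eq_sum_of_support E _ hσ, sum_permLabel]
    exact (le_sup (f := fun x : E => permLabel σ x.1) (mem_attach E f)).trans_eq h_max.symm
  rw [h_total, h_total, mul_le_mul_iff_right₀ two_pos,
    div_le_div_iff_of_pos_right (Nat.cast_pos.2 (Nat.pos_of_ne_zero hr)), Nat.cast_le] at h_le
  simpa only [B, dif_pos f.2, dif_pos he] using h_le
end
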